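/- arXiv:1611.10058 — 4 statements merged into one kernel-verified Lean document; each statement's English description precedes it below -/
import Mathlib

section
/- Let S be a set of 2n points in regular wheel configuration in the plane, with n ≥ 3 odd, and let k = ⌈n/2⌉. Suppose F_1, F_2, …, F_k are pairwise edge-disjoint non-crossing perfect matchings on S such that G = F_1 ∪ … ∪ F_k is a triangle-free geometric graph. Then every matching F_i has exactly two boundary edges if and only if the radial edges of G are in consecutive order, i.e., the k circle points incident with radial edges of G are k consecutive points on the circle. -/
noncomputable section

open Classical

/-- A point of the plane. -/
abbrev Pt : Type := ℝ × ℝ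

/-- The signed-area determinant of the ordered triple `(p, q, r)`; it is positive iff
`r` lies strictly on the left of the directed line from `p` to `q`. -/
def det2 (p q r : Pt) : ℝ :=
  (q.1 - p.1) * (r.2 - p.2) - (q.2 - p.2) * (r.1 - p.1)

/-- A set of points is in general position if no three distinct points of it are collinear. -/
def GenPos (S : Set Pt) : Prop :=
  ∀ p ∈ S, ∀ q ∈ S, ∀ r ∈ S, p ≠ q → p ≠ r → q ≠ r →
    ¬ Collinear ℝ ({p, q, r} : Set Pt)

/-- `e` is a straight-line edge with (two distinct) endpoints in `S`,
represented as the two-element set of its endpoints. -/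
def IsEdgeOn (S : Set Pt) (e : Set Pt) : Prop :=
  ∃ a b : Pt, a ≠ b ∧ a ∈ S ∧ b ∈ S ∧ e = {a, b}

/-- `F` is a perfect matching on the point set `S`: every edge of `F` joins two points
of `S`, and every point of `S` lies on exactly one edge of `F`. -/
def IsPerfectMatching (S : Set Pt) (F : Set (Set Pt)) : Prop :=
  (∀ e ∈ F, IsEdgeOn S e) ∧ ∀ p ∈ S, ∃! e, e ∈ F ∧ p ∈ e

/-- The set of points interior to the edge `e` (the open segment between its endpoints). -/
def openSeg (e : Set Pt) : Set Pt :=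
  {x | ∃ a ∈ e, ∃ b ∈ e, a ≠ b ∧ x ∈ openSegment ℝ a b}

/-- A set of edges is non-crossing if no two distinct edges have a common point
interior to both. -/
def NonCrossing (E : Set (Set Pt)) : Prop :=
  ∀ e ∈ E, ∀ f ∈ E, e ≠ f → openSeg e ∩ openSeg f = ∅

/-- A geometric graph (given by its edge set `E`) is triangle-free if no three pairwise
distinct points are pairwise joined by edges of `E`. -/
def TriangleFree (E : Set (Set Pt)) : Prop :=
  ¬ ∃ p q r : Pt, p ≠ q ∧ p ≠ r ∧ q ≠ r ∧
      ({p, q} : Set Pt) ∈ E ∧ ({q, r} : Set Pt) ∈ E ∧ ({p, r} : Set Pt) ∈ E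

/-- `2*n` points in regular wheel configuration: `x` is the center and
`u 0, u 1, …, u (2n−2)` are regularly spaced on a circle around `x`, in cyclic order. -/
def RegularWheel (n : ℕ) (x : Pt) (u : ZMod (2 * n - 1) → Pt) : Prop :=
  ∃ r θ : ℝ, 0 < r ∧ ∀ j : Fin (2 * n - 1),
    u ((j : ℕ) : ZMod (2 * n - 1)) =
      (x.1 + r * Real.cos (θ + 2 * Real.pi * (j : ℝ) / (2 * n - 1)),
       x.2 + r * Real.sin (θ + 2 * Real.pi * (j : ℝ) / (2 * n - 1)))

structure NCM (m : ℕ) (p : ℕ → ℕ) : Prop where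
  lo : ∀ t, 1 ≤ t → t ≤ 4 * m → 1 ≤ p t
  hi : ∀ t, 1 ≤ t → t ≤ 4 * m → p t ≤ 4 * m
  inv : ∀ t, 1 ≤ t → t ≤ 4 * m → p (p t) = t
  ne : ∀ t, 1 ≤ t → t ≤ 4 * m → p t ≠ t
  nc : ∀ a b, 1 ≤ a → a < b → b < p a → p a < p b → p b ≤ 4 * m → False
  len : ∀ t, 1 ≤ t → t ≤ 4 * m → p t ≤ t + 2 * m

def ClosedI (p : ℕ → ℕ) (a b : ℕ) : Prop := ∀ t, a ≤ t → t ≤ b → a ≤ p t ∧ p t ≤ b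

theorem NCM.inside {m : ℕ} {p : ℕ → ℕ} (h : NCM m p) (a b : ℕ) (ha : 1 ≤ a) (ha4 : a ≤ 4 * m)
    (hab : a < b) (hb : b < p a) : a < p b ∧ p b < p a := by
  have h1 := h.hi a ha ha4
  have hb4 : b ≤ 4 * m := by omega
  have hb1 : 1 ≤ b := by omega
  have h2 := h.lo b hb1 hb4
  have h3 := h.hi b hb1 hb4
  have h4 := h.inv b hb1 hb4
  have h5 := h.inv a ha ha4
  have e1 : p b ≠ p a := fun e => by rw [e, h5] at h4; omega
  have e2 : p b ≠ a := fun e => by rw [e] at h4; omega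
  have e3 : ¬ p a < p b := fun e => h.nc a b ha hab hb e h3
  have e4 : ¬ p b < a := fun e => by
    refine h.nc (p b) a h2 e (by omega) (by omega) h1
  omega

theorem NCM.closed_split {m : ℕ} {p : ℕ → ℕ} (h : NCM m p) (a b : ℕ) (ha : 1 ≤ a) (hb : b ≤ 4 * m)
    (hab : a ≤ b) (hc : ClosedI p a b) :
    a < p a ∧ p a ≤ b ∧ ClosedI p (a + 1) (p a - 1) ∧ ClosedI p (p a + 1) b ∧ ClosedI p a (p a) := by
  have ha4 : a ≤ 4 * m := by omega
  have h0 := hc a le_rfl hab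
  have h1 := h.ne a ha ha4
  have hlt : a < p a := by omega
  have hi := h.inv a ha ha4
  refine ⟨hlt, h0.2, ?_, ?_, ?_⟩
  · intro t ht1 ht2
    have := h.inside a t ha ha4 (by omega) (by omega)
    omega
  · intro t ht1 ht2
    have h2 := hc t (by omega) ht2
    have h3 := h.inv t (by omega) (by omega)
    refine ⟨?_, h2.2⟩
    by_contra hcon
    rcases Nat.lt_or_ge a (p t) with h4 | h4
    · rcases Nat.lt_or_ge (p t) (p a) with h5 | h5
      · have := h.inside a (p t) ha ha4 h4 h5
        omega
      · have : p t = p a := by omega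
        rw [this, hi] at h3; omega
    · have : p t = a := by omega
      rw [this] at h3; omega
  · intro t ht1 ht2
    rcases Nat.lt_or_ge a t with h4 | h4
    · rcases Nat.lt_or_ge t (p a) with h5 | h5
      · have := h.inside a t ha ha4 h4 h5
        omega
      · have : t = p a := by omega
        rw [this, hi]; omega
    · have : t = a := by omega
      rw [this]; omega

theorem NCM.even {m : ℕ} {p : ℕ → ℕ} (h : NCM m p) : ∀ (L a b : ℕ), b + 1 - a ≤ L → 1 ≤ a →
    b ≤ 4 * m → a ≤ b + 1 → ClosedI p a b → (b + 1 - a) % 2 = 0 := by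
  intro L
  induction L with
  | zero => intro a b hL ha hb hab hc; omega
  | succ L ih =>
    intro a b hL ha hb hab hc
    rcases Nat.lt_or_ge b a with h1 | h1
    · omega
    · obtain ⟨h2, h3, h4, h5, h6⟩ := h.closed_split a b ha hb h1 hc
      have e1 := ih (a + 1) (p a - 1) (by omega) (by omega) (by omega) (by omega) h4
      have e2 := ih (p a + 1) b (by omega) (by omega) (by omega) (by omega) h5
      omega

theorem NCM.closed_arc {m : ℕ} {p : ℕ → ℕ} (h : NCM m p) (a : ℕ) (ha : 1 ≤ a) (ha4 : a ≤ 4 * m)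
    (hlt : a < p a) : ClosedI p (a + 1) (p a - 1) := by
  intro t ht1 ht2
  have := h.inside a t ha ha4 (by omega) (by omega)
  omega

theorem NCM.odd {m : ℕ} {p : ℕ → ℕ} (h : NCM m p) (t : ℕ) (ht : 1 ≤ t) (ht4 : t ≤ 4 * m) :
    (p t + t) % 2 = 1 := by
  have h0 := h.ne t ht ht4
  have h1 := h.lo t ht ht4
  have h2 := h.hi t ht ht4
  have h3 := h.inv t ht ht4
  rcases Nat.lt_or_ge t (p t) with h4 | h4
  · have := h.even _ (t + 1) (p t - 1) le_rfl (by omega) (by omega) (by omega)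
      (h.closed_arc t ht ht4 h4)
    omega
  · have h5 := h.closed_arc (p t) h1 h2 (by omega)
    rw [h3] at h5
    have := h.even _ (p t + 1) (t - 1) le_rfl (by omega) (by omega) (by omega) h5
    omega

theorem NCM.has_bdry {m : ℕ} {p : ℕ → ℕ} (h : NCM m p) : ∀ (L a b : ℕ), b + 1 - a ≤ L → 1 ≤ a →
    b ≤ 4 * m → a ≤ b → ClosedI p a b → ∃ t, a ≤ t ∧ t < b ∧ p t = t + 1 := by
  intro L
  induction L with
  | zero => intro a b hL ha hb hab hc; omega
  | succ L ih =>
    intro a b hL ha hb hab hc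
    obtain ⟨h2, h3, h4, h5, h6⟩ := h.closed_split a b ha hb hab hc
    rcases Nat.lt_or_ge (a + 1) (p a) with h7 | h7
    · obtain ⟨t, e1, e2, e3⟩ := ih (a + 1) (p a - 1) (by omega) (by omega) (by omega) (by omega) h4
      exact ⟨t, by omega, by omega, e3⟩
    · exact ⟨a, le_rfl, by omega, by omega⟩

theorem NCM.rainbow {m : ℕ} {p : ℕ → ℕ} (h : NCM m p) : ∀ (L a b : ℕ), b + 1 - a ≤ L → 1 ≤ a →
    b ≤ 4 * m → ClosedI p a b →
    (∀ s t, a ≤ s → s < b → a ≤ t → t < b → p s = s + 1 → p t = t + 1 → s = t) →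
    ∀ t, a ≤ t → t ≤ b → p t = a + b - t := by
  intro L
  induction L with
  | zero => intro a b hL ha hb hc hu t h1 h2; omega
  | succ L ih =>
    intro a b hL ha hb hc hu t ht1 ht2
    obtain ⟨h2, h3, h4, h5, h6⟩ := h.closed_split a b ha hb (by omega) hc
    have hpa : p a = b := by
      by_contra hne
      obtain ⟨s, e1, e2, e3⟩ := h.has_bdry _ a (p a) le_rfl ha (by omega) (by omega) h6
      obtain ⟨s', f1, f2, f3⟩ := h.has_bdry _ (p a + 1) b le_rfl (by omega) (by omega) (by omega) h5
      have := hu s s' (by omega) (by omega) (by omega) (by omega) e3 f3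
      omega
    have hpb : p b = a := by rw [← hpa]; exact h.inv a ha (by omega)
    rcases Nat.lt_or_ge a t with g1 | g1
    · rcases Nat.lt_or_ge t b with g2 | g2
      · rw [hpa] at h4
        have := ih (a + 1) (b - 1) (by omega) (by omega) (by omega) h4
          (fun s t h1 h2 h3 h4 => hu s t (by omega) (by omega) (by omega) (by omega))
          t (by omega) (by omega)
        omega
      · have : t = b := by omega
        rw [this, hpb]; omega
    · have : t = a := by omega
      rw [this, hpa]; omega

def DR (m : ℕ) (p : ℕ → ℕ) : Prop :=
  (∀ t, 1 ≤ t → t ≤ 2 * m → p t = 2 * m + 1 - t) ∧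
  (∀ t, 2 * m + 1 ≤ t → t ≤ 4 * m → p t = 6 * m + 1 - t)

theorem NCM.dr_of_two {m : ℕ} {p : ℕ → ℕ} (hm : 1 ≤ m) (h : NCM m p)
    (h2 : {t : ℕ | 1 ≤ t ∧ t ≤ 4 * m ∧ p t = t + 1}.ncard = 2) : DR m p := by
  have hc : ClosedI p 1 (4 * m) := fun t h1 h2 => ⟨h.lo t h1 h2, h.hi t h1 h2⟩
  obtain ⟨g2, g3, g4, g5, g6⟩ := h.closed_split 1 (4 * m) le_rfl le_rfl (by omega) hc
  have hl := h.len 1 le_rfl (by omega)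
  have ho := h.odd 1 le_rfl (by omega)
  obtain ⟨x, y, hxy, hS⟩ := Set.ncard_eq_two.1 h2
  have hmem : ∀ t, 1 ≤ t → t ≤ 4 * m → p t = t + 1 → t = x ∨ t = y := by
    intro t h1 h2 h3
    have : t ∈ {t : ℕ | 1 ≤ t ∧ t ≤ 4 * m ∧ p t = t + 1} := ⟨h1, h2, h3⟩
    rw [hS] at this
    simpa using this
  obtain ⟨s, e1, e2, e3⟩ := h.has_bdry _ 1 (p 1) le_rfl le_rfl (by omega) (by omega) g6
  obtain ⟨s', f1, f2, f3⟩ := h.has_bdry _ (p 1 + 1) (4 * m) le_rfl (by omega) (by omega) (by omega) g5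
  have hs := hmem s (by omega) (by omega) e3
  have hs' := hmem s' (by omega) (by omega) f3
  have R1 := h.rainbow _ 1 (p 1) le_rfl le_rfl (by omega) g6 (by
    intro a b h1 h2 h3 h4 h5 h6
    have := hmem a (by omega) (by omega) h5
    have := hmem b (by omega) (by omega) h6
    omega)
  have R2 := h.rainbow _ (p 1 + 1) (4 * m) le_rfl (by omega) (by omega) g5 (by
    intro a b h1 h2 h3 h4 h5 h6
    have := hmem a (by omega) (by omega) h5
    have := hmem b (by omega) (by omega) h6
    omega)
  have hl2 := h.len (p 1 + 1) (by omega) (by omega)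
  rw [R2 _ le_rfl (by omega)] at hl2
  have hp : p 1 = 2 * m := by omega
  rw [hp] at R1 R2
  refine ⟨fun t h1 h2 => ?_, fun t h1 h2 => ?_⟩
  · rw [R1 t h1 h2]; omega
  · rw [R2 t h1 h2]; omega

theorem two_of_dr {m : ℕ} {p : ℕ → ℕ} (hm : 1 ≤ m) (h : DR m p) :
    {t : ℕ | 1 ≤ t ∧ t ≤ 4 * m ∧ p t = t + 1}.ncard = 2 := by
  have : {t : ℕ | 1 ≤ t ∧ t ≤ 4 * m ∧ p t = t + 1} = {m, 3 * m} := by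
    ext t
    simp only [Set.mem_ofPred_eq, Set.mem_insert_iff, Set.mem_singleton_iff]
    constructor
    · rintro ⟨h1, h2, h3⟩
      rcases Nat.lt_or_ge (2 * m) t with g | g
      · rw [h.2 t (by omega) h2] at h3; omega
      · rw [h.1 t (by omega) g] at h3; omega
    · rintro (rfl | rfl)
      · exact ⟨by omega, by omega, by rw [h.1 _ (by omega) (by omega)]; omega⟩
      · exact ⟨by omega, by omega, by rw [h.2 _ (by omega) (by omega)]; omega⟩
  rw [this]
  exact Set.ncard_pair (by omega)

/-- family of matchings with consecutive radial vertices -/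
structure Fam (m : ℕ) (p : ℕ → ℕ → ℕ) : Prop where
  ncm : ∀ w, w ≤ m → NCM m (p w)
  out : ∀ w, w ≤ m → ∀ t, 1 ≤ t → t ≤ 4 * m → (t ≤ m - w ∨ 4 * m + 1 - w ≤ t) →
    m - w + 1 ≤ p w t ∧ p w t ≤ 4 * m - w
  dis : ∀ w w', w ≤ m → w' ≤ m → w ≠ w' → ∀ t t', 1 ≤ t → t ≤ 4 * m → 1 ≤ t' → t' ≤ 4 * m →
    (w + t ≡ w' + t' [MOD (4 * m + 1)]) → (w + p w t ≡ w' + p w' t' [MOD (4 * m + 1)]) → False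

theorem modEq_reflect {m a b a' b' : ℕ} 
    (h : a ≡ b [MOD (4 * m + 1)]) (e1 : a + a' = 5 * m + 1) (e2 : b + b' = 5 * m + 1) :
    a' ≡ b' [MOD (4 * m + 1)] := by
  have : a + a' ≡ b + b' [MOD (4 * m + 1)] := by rw [e1, e2]
  exact Nat.ModEq.add_left_cancel h this

theorem Fam.reflect {m : ℕ} {p : ℕ → ℕ → ℕ} (h : Fam m p) :
    Fam m (fun w t => 4 * m + 1 - p (m - w) (4 * m + 1 - t)) := by
  refine ⟨?_, ?_, ?_⟩
  · intro w hw
    have H := h.ncm (m - w) (by omega)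
    refine ⟨?_, ?_, ?_, ?_, ?_, ?_⟩
    · intro t h1 h2
      have := H.hi (4 * m + 1 - t) (by omega) (by omega)
      show 1 ≤ 4 * m + 1 - _
      omega
    · intro t h1 h2
      have := H.lo (4 * m + 1 - t) (by omega) (by omega)
      show 4 * m + 1 - _ ≤ _
      omega
    · intro t h1 h2
      have a1 := H.lo (4 * m + 1 - t) (by omega) (by omega)
      have a2 := H.hi (4 * m + 1 - t) (by omega) (by omega)
      have a3 := H.inv (4 * m + 1 - t) (by omega) (by omega)
      show 4 * m + 1 - p (m - w) (4 * m + 1 - (4 * m + 1 - p (m - w) (4 * m + 1 - t))) = t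
      rw [show 4 * m + 1 - (4 * m + 1 - p (m - w) (4 * m + 1 - t)) = p (m - w) (4 * m + 1 - t) by omega, a3]
      omega
    · intro t h1 h2
      have := H.ne (4 * m + 1 - t) (by omega) (by omega)
      have := H.hi (4 * m + 1 - t) (by omega) (by omega)
      show 4 * m + 1 - _ ≠ _
      omega
    · intro a b ha hab hb hc hd
      have hb4 : b ≤ 4 * m := by omega
      have a1 := H.lo (4 * m + 1 - a) (by omega) (by omega)
      have a2 := H.hi (4 * m + 1 - a) (by omega) (by omega)
      have a3 := H.inv (4 * m + 1 - a) (by omega) (by omega)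
      have b1 := H.lo (4 * m + 1 - b) (by omega) (by omega)
      have b2 := H.hi (4 * m + 1 - b) (by omega) (by omega)
      have b3 := H.inv (4 * m + 1 - b) (by omega) (by omega)
      exact H.nc (p (m - w) (4 * m + 1 - b)) (p (m - w) (4 * m + 1 - a)) b1 (by omega)
        (by omega) (by omega) (by omega)
    · intro t h1 h2
      have a1 := H.lo (4 * m + 1 - t) (by omega) (by omega)
      have a2 := H.hi (4 * m + 1 - t) (by omega) (by omega)
      have a3 := H.inv (4 * m + 1 - t) (by omega) (by omega)
      have := H.len _ a1 a2
      show 4 * m + 1 - _ ≤ _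
      omega
  · intro w hw t h1 h2 h3
    have := h.out (m - w) (by omega) (4 * m + 1 - t) (by omega) (by omega) (by omega)
    omega
  · intro w w' hw hw' hne t t' h1 h2 h3 h4 h5 h6
    have a1 := (h.ncm (m - w) (by omega)).lo (4 * m + 1 - t) (by omega) (by omega)
    have a2 := (h.ncm (m - w) (by omega)).hi (4 * m + 1 - t) (by omega) (by omega)
    have b1 := (h.ncm (m - w') (by omega)).lo (4 * m + 1 - t') (by omega) (by omega)
    have b2 := (h.ncm (m - w') (by omega)).hi (4 * m + 1 - t') (by omega) (by omega)
    refine h.dis (m - w) (m - w') (by omega) (by omega) (by omega) (4 * m + 1 - t) (4 * m + 1 - t')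
      (by omega) (by omega) (by omega) (by omega) ?_ ?_
    · exact modEq_reflect h5 (by omega) (by omega)
    · exact modEq_reflect h6 (by omega) (by omega)

theorem Fam.left {m : ℕ} {p : ℕ → ℕ → ℕ} (h : Fam m p) : ∀ w, w ≤ m → ∀ t, 1 ≤ t → t ≤ m - w →
    p w t = 2 * m + 1 - t := by
  intro w
  induction w using Nat.strong_induction_on with
  | _ w ih =>
  intro hw t ht1 ht2
  have H := h.ncm w hw
  have hup : ∀ i, i + 1 ≤ m - w → p w (i + 1) ≤ 2 * m - i := by
    intro i
    induction i with
    | zero =>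
      intro hi
      have := H.len 1 le_rfl (by omega)
      have := H.odd 1 le_rfl (by omega)
      show p w 1 ≤ _
      omega
    | succ i ihi =>
      intro hi
      have h1 := ihi (by omega)
      have h2 := h.out w hw (i + 1) (by omega) (by omega) (by omega)
      have h3 := h.out w hw (i + 2) (by omega) (by omega) (by omega)
      have := H.inside (i + 1) (i + 2) (by omega) (by omega) (by omega) (by omega)
      show p w (i + 2) ≤ _
      omega
  have hlo : ∀ i, i < m - w → (m - w) + 1 + i ≤ p w (m - w - i) := by
    intro i
    induction i with
    | zero =>
      intro hi
      have := h.out w hw (m - w) (by omega) (by omega) (by omega)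
      show _ ≤ p w (m - w)
      omega
    | succ i ihi =>
      intro hi
      have h1 := ihi (by omega)
      have h2 := h.out w hw (m - w - i) (by omega) (by omega) (by omega)
      have h3 := h.out w hw (m - w - (i + 1)) (by omega) (by omega) (by omega)
      have := H.inside (m - w - (i + 1)) (m - w - i) (by omega) (by omega) (by omega) (by omega)
      omega
  have h1 := hup (t - 1) (by omega)
  have h2 := hlo (m - w - t) (by omega)
  rw [show t - 1 + 1 = t by omega] at h1
  rw [show m - w - (m - w - t) = t by omega] at h2
  have h3 := H.odd t ht1 (by omega)
  by_contra hne
  -- p w t + t + 2 w = 2 m + 1 + 2 w'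
  obtain ⟨w', hw'⟩ : ∃ w', p w t + t + 2 * w = 2 * m + 1 + 2 * w' :=
    ⟨(p w t + t + 2 * w - (2 * m + 1)) / 2, by omega⟩
  have hlt : w' < w := by omega
  have := ih w' hlt (by omega) (t + w - w') (by omega) (by omega)
  refine h.dis w w' hw (by omega) (by omega) t (t + w - w') ht1 (by omega) (by omega) (by omega) ?_ ?_
  · rw [show w' + (t + w - w') = w + t by omega]
  · rw [this, show w' + (2 * m + 1 - (t + w - w')) = w + p w t by omega]

theorem Fam.right {m : ℕ} {p : ℕ → ℕ → ℕ} (h : Fam m p) : ∀ w, w ≤ m → ∀ t, 4 * m + 1 - w ≤ t →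
    t ≤ 4 * m → p w t = 6 * m + 1 - t := by
  intro w hw t h1 h2
  have := h.reflect.left (m - w) (by omega) (4 * m + 1 - t) (by omega) (by omega)
  rw [show m - (m - w) = w by omega, show 4 * m + 1 - (4 * m + 1 - t) = t by omega] at this
  have := (h.ncm w hw).hi t (by omega) h2
  omega

theorem Fam.midR {m : ℕ} {p : ℕ → ℕ → ℕ} (h : Fam m p) : ∀ d w, w + d = m → ∀ t,
    2 * m + w + 1 ≤ t → t ≤ 4 * m - w → p w t = 6 * m + 1 - t := by
  intro d
  induction d using Nat.strong_induction_on with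
  | _ d ih =>
  intro w hwd
  have hw : w ≤ m := by omega
  have H := h.ncm w hw
  have hcl : ∀ t, 2 * m + w + 1 ≤ t → t ≤ 4 * m - w → 2 * m + w + 1 ≤ p w t ∧ p w t ≤ 4 * m - w := by
    intro t h1 h2
    rcases Nat.eq_zero_or_pos w with h0 | h0
    · subst h0
      refine ⟨?_, H.hi t (by omega) (by omega)⟩
      by_contra hc
      have a1 := H.lo t (by omega) (by omega)
      have a2 := H.inv t (by omega) (by omega)
      rcases Nat.lt_or_ge m (p 0 t) with g | g
      · have b := h.left 0 (by omega) (2 * m + 1 - p 0 t) (by omega) (by omega)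
        have c := H.inv (2 * m + 1 - p 0 t) (by omega) (by omega)
        rw [b, show 2 * m + 1 - (2 * m + 1 - p 0 t) = p 0 t by omega] at c
        omega
      · have := h.left 0 (by omega) (p 0 t) a1 (by omega)
        omega
    · have b := h.right w hw (4 * m + 1 - w) (by omega) (by omega)
      have c := H.inv (4 * m + 1 - w) (by omega) (by omega)
      rw [b, show 6 * m + 1 - (4 * m + 1 - w) = 2 * m + w by omega] at c
      have := H.inside (2 * m + w) t (by omega) (by omega) (by omega) (by omega)
      omega
  have hsum : ∀ t, 2 * m + w + 1 ≤ t → t ≤ 4 * m - w → p w t + t ≤ 6 * m + 1 := by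
    intro t h1 h2
    by_contra hc
    have h3 := H.odd t (by omega) (by omega)
    have h4 := hcl t h1 h2
    obtain ⟨e, he⟩ : ∃ e, p w t + t = 6 * m + 1 + 2 * e := ⟨(p w t + t - (6 * m + 1)) / 2, by omega⟩
    have := ih (d - e) (by omega) (w + e) (by omega) (t - e) (by omega) (by omega)
    refine h.dis w (w + e) hw (by omega) (by omega) t (t - e) (by omega) (by omega) (by omega)
      (by omega) ?_ ?_
    · rw [show w + e + (t - e) = w + t by omega]
    · rw [this, show w + e + (6 * m + 1 - (t - e)) = w + p w t by omega]
  have key : ∀ i, i < 2 * (m - w) → p w (4 * m - w - i) = 2 * m + w + 1 + i := by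
    intro i
    induction i using Nat.strong_induction_on with
    | _ i ihi =>
    intro hi
    have a1 := hcl (4 * m - w - i) (by omega) (by omega)
    have a2 := hsum (4 * m - w - i) (by omega) (by omega)
    by_contra hne
    have a3 := ihi (p w (4 * m - w - i) - (2 * m + w + 1)) (by omega) (by omega)
    rw [show 2 * m + w + 1 + (p w (4 * m - w - i) - (2 * m + w + 1)) = p w (4 * m - w - i) by omega] at a3
    have b1 := H.inv (4 * m - w - i) (by omega) (by omega)
    have b2 := H.inv (4 * m - w - (p w (4 * m - w - i) - (2 * m + w + 1))) (by omega) (by omega)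
    rw [a3] at b2
    omega
  intro t h1 h2
  have := key (4 * m - w - t) (by omega)
  rw [show 4 * m - w - (4 * m - w - t) = t by omega] at this
  omega

theorem Fam.midL {m : ℕ} {p : ℕ → ℕ → ℕ} (h : Fam m p) : ∀ w, w ≤ m → ∀ t, m - w + 1 ≤ t →
    t ≤ m + w → p w t = 2 * m + 1 - t := by
  intro w hw t h1 h2
  have := h.reflect.midR w (m - w) (by omega) (4 * m + 1 - t) (by omega) (by omega)
  rw [show m - (m - w) = w by omega, show 4 * m + 1 - (4 * m + 1 - t) = t by omega] at this
  have := (h.ncm w hw).hi t (by omega) (by omega)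
  omega

theorem Fam.dr {m : ℕ} {p : ℕ → ℕ → ℕ} (h : Fam m p) (w : ℕ) (hw : w ≤ m) : DR m (p w) := by
  have H := h.ncm w hw
  constructor
  · intro t h1 h2
    by_cases c1 : t ≤ m - w
    · exact h.left w hw t h1 c1
    by_cases c2 : t ≤ m + w
    · exact h.midL w hw t (by omega) c2
    have := h.left w hw (2 * m + 1 - t) (by omega) (by omega)
    have c := H.inv (2 * m + 1 - t) (by omega) (by omega)
    rw [this, show 2 * m + 1 - (2 * m + 1 - t) = t by omega] at c
    exact c
  · intro t h1 h2
    by_cases c1 : 4 * m + 1 - w ≤ t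
    · exact h.right w hw t c1 h2
    by_cases c2 : 2 * m + w + 1 ≤ t
    · exact h.midR (m - w) w (by omega) t c2 (by omega)
    have := h.right w hw (6 * m + 1 - t) (by omega) (by omega)
    have c := H.inv (6 * m + 1 - t) (by omega) (by omega)
    rw [this, show 6 * m + 1 - (6 * m + 1 - t) = t by omega] at c
    exact c

open Classical in
theorem two_class {m : ℤ} {A B : Finset ℤ} (hA : A.Nonempty) (hB : B.Nonempty)
    (hAA : ∀ a ∈ A, ∀ a' ∈ A, a' - a ≤ m) (hBB : ∀ a ∈ B, ∀ a' ∈ B, a' - a ≤ m)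
    (hAB : ∀ a ∈ A, ∀ b ∈ B, m + 1 ≤ b - a ∧ b - a ≤ 3 * m ∧ b - a ≠ 2 * m ∧ b - a ≠ 2 * m + 1) :
    (A.card : ℤ) + B.card ≤ m := by
  obtain ⟨a0, ha0, ha0'⟩ := A.exists_min_image id hA
  obtain ⟨a1, ha1, ha1'⟩ := A.exists_max_image id hA
  obtain ⟨b0, hb0, hb0'⟩ := B.exists_min_image id hB
  obtain ⟨b1, hb1, hb1'⟩ := B.exists_max_image id hB
  simp only [id] at ha0' ha1' hb0' hb1'
  have x1 := hAA a0 ha0 a1 ha1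
  have x2 := hBB b0 hb0 b1 hb1
  have x3 := hAB a0 ha0 b0 hb0
  have x4 := hAB a0 ha0 b1 hb1
  have x5 := hAB a1 ha1 b0 hb0
  have x6 := hAB a1 ha1 b1 hb1
  have y1 := ha0' a1 ha1
  have y2 := hb0' b1 hb1
  -- general bound
  have gen : ∀ s : ℤ, (s = 2 * m ∨ s = 2 * m + 1) → ∀ lo hi : ℤ, lo ≤ a0 → lo ≤ b0 - s → a1 ≤ hi →
      b1 - s ≤ hi → (A.card : ℤ) + B.card ≤ hi - lo + 1 := by
    intro s hs lo hi h1 h2 h3 h4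
    have hd : Disjoint A (B.image (fun b => b - s)) := by
      rw [Finset.disjoint_left]
      intro a ha hb
      simp only [Finset.mem_image] at hb
      obtain ⟨b, hb, rfl⟩ := hb
      have := hAB _ ha b hb
      omega
    have hc : (B.image (fun b => b - s)).card = B.card :=
      Finset.card_image_of_injective _ (fun x y h => by simpa using h)
    have hsub : A ∪ B.image (fun b => b - s) ⊆ Finset.Icc lo hi := by
      intro z hz
      simp only [Finset.mem_union, Finset.mem_image] at hz
      rw [Finset.mem_Icc]
      rcases hz with hz | ⟨b, hb, rfl⟩
      · have := ha0' z hz; have := ha1' z hz; omega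
      · have := hb0' b hb; have := hb1' b hb; omega
    have := Finset.card_le_card hsub
    rw [Finset.card_union_of_disjoint hd, hc, Int.card_Icc] at this
    omega
  have gen2 : ∀ (s c lo hi : ℤ), (s = 2 * m ∨ s = 2 * m + 1) → c ∉ A → c + s ∉ B → 
      lo ≤ a0 → lo ≤ b0 - s → a1 ≤ hi → b1 - s ≤ hi → lo ≤ c → c ≤ hi → 
      (A.card : ℤ) + B.card + 1 ≤ hi - lo + 1 := by
    intro s c lo hi hs hcA hcB h1 h2 h3 h4 h5 h6
    have hd : Disjoint A (B.image (fun b => b - s)) := by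
      rw [Finset.disjoint_left]
      intro a ha hb
      simp only [Finset.mem_image] at hb
      obtain ⟨b, hb, rfl⟩ := hb
      have := hAB _ ha b hb
      omega
    have hc : (B.image (fun b => b - s)).card = B.card :=
      Finset.card_image_of_injective _ (fun x y h => by simpa using h)
    have hni : c ∉ A ∪ B.image (fun b => b - s) := by
      simp only [Finset.mem_union, Finset.mem_image, not_or]
      refine ⟨hcA, ?_⟩
      rintro ⟨b, hb, rfl⟩
      apply hcB
      simpa using hb
    have hsub : insert c (A ∪ B.image (fun b => b - s)) ⊆ Finset.Icc lo hi := by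
      intro z hz
      simp only [Finset.mem_insert, Finset.mem_union, Finset.mem_image] at hz
      rw [Finset.mem_Icc]
      rcases hz with rfl | hz | ⟨b, hb, rfl⟩
      · omega
      · have := ha0' z hz; have := ha1' z hz; omega
      · have := hb0' b hb; have := hb1' b hb; omega
    have := Finset.card_le_card hsub
    rw [Finset.card_insert_of_notMem hni, Finset.card_union_of_disjoint hd, hc, Int.card_Icc] at this
    omega
  rcases lt_or_ge a0 (b0 - 2 * m) with c1 | c1
  · rcases lt_or_ge a1 (b1 - 2 * m) with c2 | c2
    · have := gen (2 * m + 1) (Or.inr rfl) a0 (b1 - 2 * m - 1) (by omega) (by omega) (by omega) (by omega)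
      omega
    · have := gen2 (2 * m) (b0 - 2 * m - 1) a0 a1 (Or.inl rfl)
        (fun h => by have := hAB _ h b0 hb0; omega)
        (fun h => by have := hb0' _ h; omega)
        (by omega) (by omega) (by omega) (by omega) (by omega) (by omega)
      omega
  · rcases lt_or_ge a1 (b1 - 2 * m) with c2 | c2
    · have := gen2 (2 * m) (a1 + 1) (b0 - 2 * m) (b1 - 2 * m) (Or.inl rfl)
        (fun h => by have := ha1' _ h; omega)
        (fun h => by have := hAB _ ha1 _ h; omega)
        (by omega) (by omega) (by omega) (by omega) (by omega) (by omega)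
      omega
    · have := gen (2 * m) (Or.inl rfl) (b0 - 2 * m) a1 (by omega) (by omega) (by omega) (by omega)
      omega

open Classical in
theorem int_consec {m : ℤ} (hm : 1 ≤ m) (P : ℤ → Prop) (hper : ∀ k, P (k + (4 * m + 1)) ↔ P k)
    (h0 : P 0) (H0 : ∀ k, P k → P (k + 2 * m) → False)
    (H1 : ∀ v g h, m + 1 ≤ g → m + 1 ≤ h → g + h ≤ 3 * m → P v → P (v + g) → P (v + (g + h)) → False)
    (H2 : ∀ v g w, m + 1 ≤ g → g ≤ 2 * m - 1 → g - m ≤ w → w ≤ m → P v → P (v + g) → P (v + w) → False)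
    (hcard : ((Finset.Icc (-m) (3 * m)).filter P).card = m + 1) :
    ∃ a : ℤ, ∀ k, -m ≤ k → k ≤ 3 * m → (P k ↔ a ≤ k ∧ k ≤ a + m) := by
  set A := (Finset.Icc (-m) m).filter P with hAdef
  set B := (Finset.Icc (m + 1) (3 * m)).filter P with hBdef
  have mA : ∀ a, a ∈ A ↔ (-m ≤ a ∧ a ≤ m) ∧ P a := by intro a; simp [hAdef]
  have mB : ∀ a, a ∈ B ↔ (m + 1 ≤ a ∧ a ≤ 3 * m) ∧ P a := by intro a; simp [hBdef]
  have hun : (Finset.Icc (-m) (3 * m)).filter P = A ∪ B := by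
    ext k
    rw [Finset.mem_union, mA, mB, Finset.mem_filter, Finset.mem_Icc]
    constructor
    · rintro ⟨h1, h2⟩
      rcases le_or_gt k m with h | h
      · left; exact ⟨⟨h1.1, h⟩, h2⟩
      · right; exact ⟨⟨by omega, h1.2⟩, h2⟩
    · rintro (⟨h1, h2⟩ | ⟨h1, h2⟩)
      · exact ⟨⟨by omega, by omega⟩, h2⟩
      · exact ⟨⟨by omega, by omega⟩, h2⟩
  have hdis : Disjoint A B := by
    rw [Finset.disjoint_left]
    intro a h1 h2
    rw [mA] at h1; rw [mB] at h2; omega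
  have hcd : (A.card : ℤ) + B.card = m + 1 := by
    rw [hun, Finset.card_union_of_disjoint hdis] at hcard
    exact_mod_cast hcard
  have H0' : ∀ k, P k → P (k + (2 * m + 1)) → False := by
    intro k h1 h2
    refine H0 _ h2 ?_
    rw [show k + (2 * m + 1) + 2 * m = k + (4 * m + 1) by ring]
    exact (hper k).2 h1
  have hA0 : (0 : ℤ) ∈ A := by rw [mA]; exact ⟨⟨by omega, by omega⟩, h0⟩
  have hAA : ∀ a ∈ A, ∀ a' ∈ A, a' - a ≤ m := by
    intro a ha a' ha'
    rw [mA] at ha ha'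
    by_contra hc
    rcases eq_or_ne (a' - a) (2 * m) with e | e
    · exact H0 a ha.2 (by rw [show a + 2 * m = a' by omega]; exact ha'.2)
    · exact H2 a (a' - a) (-a) (by omega) (by omega) (by omega) (by omega) ha.2
        (by rw [show a + (a' - a) = a' by ring]; exact ha'.2)
        (by rw [show a + -a = 0 by ring]; exact h0)
  have hB0 : ∀ b ∈ B, b ≠ 2 * m ∧ b ≠ 2 * m + 1 := by
    intro b hb
    rw [mB] at hb
    exact ⟨fun e => H0 0 h0 (by rw [zero_add, ← e]; exact hb.2),
      fun e => H0' 0 h0 (by rw [zero_add, ← e]; exact hb.2)⟩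
  by_cases hBe : B.Nonempty
  · exfalso
    have := two_class (m := m) ⟨0, hA0⟩ hBe hAA ?_ ?_
    · omega
    · intro b hb b' hb'
      by_contra hc
      have q := hB0 b hb
      have q' := hB0 b' hb'
      rw [mB] at hb hb'
      exact H1 0 b (b' - b) (by omega) (by omega) (by omega) h0 (by rw [zero_add]; exact hb.2)
        (by rw [show 0 + (b + (b' - b)) = b' by ring]; exact hb'.2)
    · intro a ha b hb
      have q := hB0 b hb
      rw [mA] at ha; rw [mB] at hb
      refine ⟨?_, ?_, ?_, ?_⟩
      · by_contra hc
        exact H2 0 b a (by omega) (by omega) (by omega) (by omega) h0 (by rw [zero_add]; exact hb.2)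
          (by rw [zero_add]; exact ha.2)
      · by_contra hc
        refine H2 b (4 * m + 1 - b) (a + (4 * m + 1) - b) (by omega) (by omega) (by omega) (by omega) hb.2 ?_ ?_
        · rw [show b + (4 * m + 1 - b) = 0 + (4 * m + 1) by ring]; exact (hper 0).2 h0
        · rw [show b + (a + (4 * m + 1) - b) = a + (4 * m + 1) by ring]; exact (hper a).2 ha.2
      · intro e
        exact H0 a ha.2 (by rw [show a + 2 * m = b by omega]; exact hb.2)
      · intro e
        exact H0' a ha.2 (by rw [show a + (2 * m + 1) = b by omega]; exact hb.2)
  · rw [Finset.not_nonempty_iff_eq_empty] at hBe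
    rw [hBe, Finset.card_empty] at hcd
    obtain ⟨a0, ha0, ha0'⟩ := A.exists_min_image id ⟨0, hA0⟩
    simp only [id] at ha0'
    have hsub : A ⊆ Finset.Icc a0 (a0 + m) := by
      intro z hz
      rw [Finset.mem_Icc]
      have := ha0' z hz
      have := hAA a0 ha0 z hz
      omega
    have heq : A = Finset.Icc a0 (a0 + m) := by
      apply Finset.eq_of_subset_of_card_le hsub
      rw [Int.card_Icc]
      omega
    refine ⟨a0, fun k h1 h2 => ?_⟩
    have : P k ↔ k ∈ A := by
      constructor
      · intro hk
        have : k ∈ A ∪ B := by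
          rw [← hun, Finset.mem_filter, Finset.mem_Icc]; exact ⟨⟨h1, h2⟩, hk⟩
        rw [hBe, Finset.union_empty] at this
        exact this
      · intro hk; exact ((mA k).1 hk).2
    rw [this, heq, Finset.mem_Icc]

theorem seg_cross (p q r s : Pt) (h1 : 0 < det2 p q r) (h2 : det2 p q s < 0) (h3 : det2 r s p < 0)
    (h4 : 0 < det2 r s q) : (openSeg {p, q} ∩ openSeg {r, s}).Nonempty := by
  have hpq : p ≠ q := by rintro rfl; simp [det2] at h1
  have hrs : r ≠ s := by rintro rfl; simp [det2] at h3
  have hD : det2 r s q - det2 r s p = det2 p q r - det2 p q s := by simp only [det2]; ring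
  have hpos : 0 < det2 p q r - det2 p q s := by linarith
  set D := det2 p q r - det2 p q s with hDdef
  refine ⟨(det2 r s q / D) • p + (-det2 r s p / D) • q, ⟨p, by simp, q, by simp, hpq, ?_⟩,
    ⟨r, by simp, s, by simp, hrs, ?_⟩⟩
  · refine ⟨_, _, div_pos h4 hpos, div_pos (by linarith) hpos, ?_, rfl⟩
    rw [← add_div, ← sub_eq_add_neg, hD, div_self hpos.ne']
  · refine ⟨-det2 p q s / D, det2 p q r / D, div_pos (by linarith) hpos, div_pos h1 hpos, ?_, ?_⟩
    · rw [← add_div, neg_add_eq_sub, ← hDdef, div_self hpos.ne']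
    · have hne := hpos.ne'
      ext
      · simp only [Prod.fst_add, Prod.smul_fst, smul_eq_mul]
        field_simp
        simp only [det2]; ring
      · simp only [Prod.snd_add, Prod.smul_snd, smul_eq_mul]
        field_simp
        simp only [det2]; ring

def circ (x : Pt) (r φ : ℝ) : Pt := (x.1 + r * Real.cos φ, x.2 + r * Real.sin φ)

theorem det_circ (x : Pt) (r a b c : ℝ) : det2 (circ x r a) (circ x r b) (circ x r c) =
    4 * r ^ 2 * (Real.sin ((b - a) / 2) * Real.sin ((c - b) / 2) * Real.sin ((c - a) / 2)) := by
  have e1 : det2 (circ x r a) (circ x r b) (circ x r c) =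
      r ^ 2 * (Real.sin (b - a) + Real.sin (c - b) - Real.sin (c - a)) := by
    simp only [det2, circ, Real.sin_sub]; ring
  rw [e1]
  obtain ⟨p, hp⟩ : ∃ p, p = (b - a) / 2 := ⟨_, rfl⟩
  obtain ⟨q, hq⟩ : ∃ q, q = (c - b) / 2 := ⟨_, rfl⟩
  rw [← hp, ← hq, show (c - a) / 2 = p + q by rw [hp, hq]; ring, show b - a = 2 * p by rw [hp]; ring,
    show c - b = 2 * q by rw [hq]; ring, show c - a = 2 * (p + q) by rw [hp, hq]; ring]
  simp only [Real.sin_two_mul, Real.sin_add, Real.cos_add]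
  have s1 := Real.sin_sq_add_cos_sq p
  have s2 := Real.sin_sq_add_cos_sq q
  have c1 : Real.cos p ^ 2 = 1 - Real.sin p ^ 2 := by linarith
  have c2 : Real.cos q ^ 2 = 1 - Real.sin q ^ 2 := by linarith
  linear_combination (-2 * r ^ 2 * Real.sin q * Real.cos q) * c1 + (-2 * r ^ 2 * Real.sin p * Real.cos p) * c2

theorem det_circ_pos (x : Pt) (r a b c : ℝ) (hr : 0 < r) (hab : a < b) (hbc : b < c)
    (hc : c < a + 2 * Real.pi) : 0 < det2 (circ x r a) (circ x r b) (circ x r c) := by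
  rw [det_circ]
  have h1 : 0 < Real.sin ((b - a) / 2) := Real.sin_pos_of_pos_of_lt_pi (by linarith) (by linarith)
  have h2 : 0 < Real.sin ((c - b) / 2) := Real.sin_pos_of_pos_of_lt_pi (by linarith) (by linarith)
  have h3 : 0 < Real.sin ((c - a) / 2) := Real.sin_pos_of_pos_of_lt_pi (by linarith) (by linarith)
  positivity

theorem det_center (x : Pt) (r a b : ℝ) :
    det2 x (circ x r a) (circ x r b) = r ^ 2 * Real.sin (b - a) := by
  simp only [det2, circ, Real.sin_sub]; ring

theorem det_cyc (p q r : Pt) : det2 p q r = det2 q r p := by simp only [det2]; ring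
theorem det_swap (p q r : Pt) : det2 p q r = - det2 q p r := by simp only [det2]; ring

theorem cross_chords (x : Pt) (r a b c d : ℝ) (hr : 0 < r) (hab : a < b) (hbc : b < c) (hcd : c < d)
    (hd : d < a + 2 * Real.pi) :
    (openSeg {circ x r a, circ x r c} ∩ openSeg {circ x r d, circ x r b}).Nonempty := by
  apply seg_cross
  · exact det_circ_pos x r a c d hr (by linarith) (by linarith) (by linarith)
  · have := det_circ_pos x r a b c hr (by linarith) (by linarith) (by linarith)
    rw [det_cyc, det_cyc, det_swap]; linarith
  · have := det_circ_pos x r a b d hr (by linarith) (by linarith) (by linarith)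
    rw [det_swap, det_cyc, det_cyc]; linarith
  · have := det_circ_pos x r b c d hr (by linarith) (by linarith) (by linarith)
    rw [det_cyc]; linarith

theorem cross_radial (x : Pt) (r a b c : ℝ) (hr : 0 < r) (hab : a < b) (hb : b < a + Real.pi)
    (hbc : b + Real.pi < c) (hc : c < a + 2 * Real.pi) :
    (openSeg {x, circ x r a} ∩ openSeg {circ x r b, circ x r c}).Nonempty := by
  have hr2 : 0 < r ^ 2 := by positivity
  have neg : ∀ y, Real.pi < y → y < 2 * Real.pi → r ^ 2 * Real.sin y < 0 := by
    intro y h1 h2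
    have := Real.sin_pos_of_pos_of_lt_pi (x := y - Real.pi) (by linarith) (by linarith)
    rw [Real.sin_sub_pi] at this
    nlinarith
  apply seg_cross
  · rw [det_center]
    exact mul_pos hr2 (Real.sin_pos_of_pos_of_lt_pi (by linarith) (by linarith))
  · rw [det_center]; exact neg _ (by linarith) (by linarith)
  · rw [det_cyc, det_cyc, det_center]; exact neg _ (by linarith) (by linarith)
  · have := Real.pi_pos
    rw [det_cyc, det_cyc]
    exact det_circ_pos x r a b c hr (by linarith) (by linarith) (by linarith)

theorem wheel_nat {n N : ℕ} {x : Pt} (hN : N = 2 * n - 1) (hn : 3 ≤ n) {r θ : ℝ}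
    {u : ZMod N → Pt}
    (h : ∀ j : Fin N, u ((j : ℕ) : ZMod N) =
      (x.1 + r * Real.cos (θ + 2 * Real.pi * (j : ℝ) / (2 * n - 1)),
       x.2 + r * Real.sin (θ + 2 * Real.pi * (j : ℝ) / (2 * n - 1)))) (j : ℕ) :
    u (j : ZMod N) = circ x r (θ + 2 * Real.pi * j / N) := by
  have hNpos : 0 < N := by omega
  have hNr : (2 * n - 1 : ℝ) = N := by
    rw [hN, Nat.cast_sub (by omega)]; push_cast; ring
  have h1 := h ⟨j % N, Nat.mod_lt _ hNpos⟩
  simp only [ZMod.natCast_mod, hNr] at h1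
  rw [h1]
  have hN0 : (N : ℝ) ≠ 0 := by positivity
  have e : θ + 2 * Real.pi * j / N = θ + 2 * Real.pi * ((j % N : ℕ) : ℝ) / N + ((j / N : ℕ) : ℝ) * (2 * Real.pi) := by
    have : (j : ℝ) = (j % N : ℕ) + N * (j / N : ℕ) := by exact_mod_cast (Nat.mod_add_div j N).symm
    rw [this]; field_simp; ring
  rw [circ, e, Real.cos_add_nat_mul_two_pi, Real.sin_add_nat_mul_two_pi]

theorem wheel_inj {N : ℕ} (hNpos : 0 < N) {x : Pt} {r θ : ℝ} (hr : 0 < r) {u : ZMod N → Pt}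
    (hu : ∀ j : ℕ, u (j : ZMod N) = circ x r (θ + 2 * Real.pi * j / N)) : Function.Injective u := by
  have : NeZero N := ⟨hNpos.ne'⟩
  intro i j hij
  rw [← ZMod.natCast_zmod_val i, ← ZMod.natCast_zmod_val j, hu, hu] at hij
  have hi := ZMod.val_lt i
  have hj := ZMod.val_lt j
  simp only [circ, Prod.mk.injEq, add_right_inj, mul_eq_mul_left_iff, hr.ne', or_false] at hij
  have hN0 : (0 : ℝ) < N := by exact_mod_cast hNpos
  have hc : Real.cos ((θ + 2 * Real.pi * i.val / N) - (θ + 2 * Real.pi * j.val / N)) = 1 := by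
    rw [Real.cos_sub, hij.1, hij.2]; nlinarith [Real.sin_sq_add_cos_sq (θ + 2 * Real.pi * j.val / N)]
  have e : (θ + 2 * Real.pi * i.val / N) - (θ + 2 * Real.pi * j.val / N) = 2 * Real.pi * (((i.val : ℝ) - j.val) / N) := by
    field_simp; ring
  rw [e] at hc
  have hi' : (i.val : ℝ) < N := by exact_mod_cast hi
  have hj' : (j.val : ℝ) < N := by exact_mod_cast hj
  have hi0 : (0 : ℝ) ≤ i.val := by positivity
  have hj0 : (0 : ℝ) ≤ j.val := by positivity
  have b1 : ((i.val : ℝ) - j.val) / N < 1 := by rw [div_lt_one hN0]; linarith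
  have b2 : -1 < ((i.val : ℝ) - j.val) / N := by rw [lt_div_iff₀ hN0]; linarith
  have hp := Real.pi_pos
  rw [Real.cos_eq_one_iff_of_lt_of_lt (by nlinarith) (by nlinarith)] at hc
  have h0 : ((i.val : ℝ) - j.val) / N = 0 := by
    rcases mul_eq_zero.1 hc with h | h
    · linarith
    · exact h
  rw [div_eq_zero_iff] at h0
  have : (i.val : ℝ) = j.val := by
    rcases h0 with h | h <;> linarith
  have : i.val = j.val := by exact_mod_cast this
  exact ZMod.val_injective N this

theorem wheel_center {N : ℕ} (hNpos : 0 < N) {x : Pt} {r θ : ℝ} (hr : 0 < r) {u : ZMod N → Pt}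
    (hu : ∀ j : ℕ, u (j : ZMod N) = circ x r (θ + 2 * Real.pi * j / N)) (j : ZMod N) : u j ≠ x := by
  have : NeZero N := ⟨hNpos.ne'⟩
  intro h
  rw [← ZMod.natCast_zmod_val j, hu, circ] at h
  have h1 := congrArg Prod.fst h
  have h2 := congrArg Prod.snd h
  simp only [add_eq_left, mul_eq_zero, hr.ne', false_or] at h1 h2
  have := Real.sin_sq_add_cos_sq (θ + 2 * Real.pi * j.val / N)
  rw [h1, h2] at this
  norm_num at this

theorem cast_inj_lt {N a b : ℕ} (ha : a < N) (hb : b < N) (h : (a : ZMod N) = b) : a = b := by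
  rw [ZMod.natCast_eq_natCast_iff'] at h
  rwa [Nat.mod_eq_of_lt ha, Nat.mod_eq_of_lt hb] at h

theorem per_matching {N m : ℕ} (hN : N = 4 * m + 1) {x : Pt} {r θ : ℝ} (hr : 0 < r)
    {u : ZMod N → Pt}
    (hu : ∀ j : ℕ, u (j : ZMod N) = circ x r (θ + 2 * Real.pi * j / N))
    {F : Set (Set Pt)} (hpm : IsPerfectMatching (insert x (Set.range u)) F) (hnc : NonCrossing F) :
    ∃ (v : ZMod N) (p : ℕ → ℕ), NCM m p ∧ ({x, u v} : Set Pt) ∈ F ∧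
      (∀ j, ({x, u j} : Set Pt) ∈ F → j = v) ∧
      (∀ t : ℕ, 1 ≤ t → t ≤ 4 * m → ({u (v + t), u (v + (p t : ℕ))} : Set Pt) ∈ F) ∧
      (∀ i j, ({u i, u j} : Set Pt) ∈ F → ∃ t : ℕ, 1 ≤ t ∧ t ≤ 4 * m ∧ i = v + t ∧ j = v + (p t : ℕ)) := by
  have hNpos : 0 < N := by omega
  have : NeZero N := ⟨hNpos.ne'⟩
  have inj := wheel_inj hNpos hr hu
  have hx := wheel_center hNpos hr hu
  obtain ⟨hE, hP⟩ := hpm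
  have uq : ∀ e f p, e ∈ F → f ∈ F → p ∈ insert x (Set.range u) → p ∈ e → p ∈ f → e = f := by
    intro e f p he hf hp h1 h2
    exact (hP p hp).unique ⟨he, h1⟩ ⟨hf, h2⟩
  have xS : x ∈ insert x (Set.range u) := by simp
  have uS : ∀ j, u j ∈ insert x (Set.range u) := fun j => by simp
  obtain ⟨v, hv⟩ : ∃ v, ({x, u v} : Set Pt) ∈ F := by
    obtain ⟨e, ⟨heF, hxe⟩, -⟩ := hP x xS
    obtain ⟨a, b, hab, ha, hb, rfl⟩ := hE e heF
    simp only [Set.mem_insert_iff, Set.mem_singleton_iff] at hxe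
    rcases hxe with rfl | rfl
    · rcases hb with rfl | ⟨j, rfl⟩
      · exact absurd rfl hab
      · exact ⟨j, heF⟩
    · rcases ha with rfl | ⟨j, rfl⟩
      · exact absurd rfl hab
      · exact ⟨j, by rw [Set.pair_comm]; exact heF⟩
  have hvu : ∀ j, ({x, u j} : Set Pt) ∈ F → j = v := by
    intro j hj
    have := uq _ _ x hj hv xS (by simp) (by simp)
    have h2 : u j ∈ ({x, u v} : Set Pt) := by rw [← this]; simp
    rcases h2 with h2 | h2
    · exact absurd h2 (hx j)
    · exact inj h2
  have hnv : ∀ i j, ({u i, u j} : Set Pt) ∈ F → i ≠ v := by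
    rintro i j h rfl
    have := uq _ _ (u i) hv h (uS i) (by simp) (by simp)
    have h2 : x ∈ ({u i, u j} : Set Pt) := by rw [← this]; simp
    rcases h2 with h2 | h2
    · exact hx _ h2.symm
    · exact hx _ h2.symm
  have hne : ∀ i j, ({u i, u j} : Set Pt) ∈ F → i ≠ j := by
    rintro i j h rfl
    obtain ⟨a, b, hab, ha, hb, e⟩ := hE _ h
    have h1 : a ∈ ({u i, u i} : Set Pt) := by rw [e]; simp
    have h2 : b ∈ ({u i, u i} : Set Pt) := by rw [e]; simp
    simp at h1 h2
    exact hab (h1.trans h2.symm)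
  have hpu : ∀ i j k, ({u i, u j} : Set Pt) ∈ F → ({u i, u k} : Set Pt) ∈ F → j = k := by
    intro i j k h1 h2
    have := uq _ _ (u i) h1 h2 (uS i) (by simp) (by simp)
    have h3 : u j ∈ ({u i, u k} : Set Pt) := by rw [← this]; simp
    rcases h3 with h3 | h3
    · exact absurd (inj h3).symm (hne i j h1)
    · exact inj h3
  have hpart : ∀ i, i ≠ v → ∃ j, ({u i, u j} : Set Pt) ∈ F := by
    intro i hi
    obtain ⟨e, ⟨heF, hxe⟩, -⟩ := hP (u i) (uS i)
    obtain ⟨a, b, hab, ha, hb, rfl⟩ := hE e heF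
    simp only [Set.mem_insert_iff, Set.mem_singleton_iff] at hxe
    rcases hxe with rfl | rfl
    · rcases hb with rfl | ⟨j, rfl⟩
      · exact absurd (hvu i (by rw [Set.pair_comm]; exact heF)) hi
      · exact ⟨j, heF⟩
    · rcases ha with rfl | ⟨j, rfl⟩
      · exact absurd (hvu i heF) hi
      · exact ⟨j, by rw [Set.pair_comm]; exact heF⟩
  have hcast : ∀ t : ℕ, 1 ≤ t → t ≤ 4 * m → v + (t : ZMod N) ≠ v := by
    intro t h1 h2 h3
    have : (t : ZMod N) = (0 : ℕ) := by simpa using h3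
    have := cast_inj_lt (by omega) (by omega) this
    omega
  have hrep : ∀ j, j ≠ v → ∃ s : ℕ, 1 ≤ s ∧ s ≤ 4 * m ∧ j = v + s := by
    intro j hj
    refine ⟨(j - v).val, ?_, ?_, ?_⟩
    · rw [Nat.one_le_iff_ne_zero, Ne, ZMod.val_eq_zero, sub_eq_zero]; exact hj
    · have := ZMod.val_lt (j - v); omega
    · rw [ZMod.natCast_zmod_val]; ring
  have hvinj : ∀ s t : ℕ, s ≤ 4 * m → t ≤ 4 * m → v + (s : ZMod N) = v + t → s = t := by
    intro s t h1 h2 h3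
    exact cast_inj_lt (by omega) (by omega) (add_left_cancel h3)
  have hex : ∀ t : ℕ, ∃ s : ℕ, 1 ≤ t → t ≤ 4 * m → 1 ≤ s ∧ s ≤ 4 * m ∧
      ({u (v + t), u (v + (s : ℕ))} : Set Pt) ∈ F := by
    intro t
    by_cases h : 1 ≤ t ∧ t ≤ 4 * m
    · obtain ⟨j, hj⟩ := hpart (v + t) (hcast t h.1 h.2)
      obtain ⟨s, h1, h2, rfl⟩ := hrep j (hnv j (v + t) (by rw [Set.pair_comm]; exact hj))
      exact ⟨s, fun _ _ => ⟨h1, h2, hj⟩⟩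
    · exact ⟨0, fun h1 h2 => absurd ⟨h1, h2⟩ h⟩
  choose p hp using hex
  -- angles
  have hang : ∀ t : ℕ, u (v + t) = circ x r ((θ + 2 * Real.pi * v.val / N) + 2 * Real.pi * t / N) := by
    intro t
    have := hu (v.val + t)
    rw [Nat.cast_add, ZMod.natCast_zmod_val] at this
    rw [this]; congr 1; push_cast; ring
  have hang0 : u v = circ x r (θ + 2 * Real.pi * v.val / N) := by
    have := hu v.val
    rwa [ZMod.natCast_zmod_val] at this
  set φ := θ + 2 * Real.pi * v.val / N
  have hNr : (0 : ℝ) < N := by exact_mod_cast hNpos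
  have hpi := Real.pi_pos
  have hlt : ∀ s t : ℕ, s < t → φ + 2 * Real.pi * s / N < φ + 2 * Real.pi * t / N := by
    intro s t h
    have : (s : ℝ) < t := by exact_mod_cast h
    gcongr
  have hpinv : ∀ t, 1 ≤ t → t ≤ 4 * m → p (p t) = t := by
    intro t h1 h2
    obtain ⟨a1, a2, a3⟩ := hp t h1 h2
    obtain ⟨b1, b2, b3⟩ := hp (p t) a1 a2
    rw [Set.pair_comm] at a3
    exact (hvinj _ _ h2 b2 (hpu _ _ _ a3 b3)).symm
  have hFne : ∀ i j k l, ({u i, u j} : Set Pt) = {u k, u l} → i = k ∨ i = l := by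
    intro i j k l h
    have : u i ∈ ({u k, u l} : Set Pt) := by rw [← h]; simp
    rcases this with h | h
    · exact Or.inl (inj h)
    · exact Or.inr (inj h)
  refine ⟨v, p, ⟨fun t h1 h2 => (hp t h1 h2).1, fun t h1 h2 => (hp t h1 h2).2.1, hpinv, ?_, ?_, ?_⟩,
    hv, hvu, fun t h1 h2 => (hp t h1 h2).2.2, ?_⟩
  · intro t h1 h2 h3
    have := (hp t h1 h2).2.2
    rw [h3] at this
    exact hne _ _ this rfl
  · intro a b ha hab hb hc hd
    by_cases hb4 : b ≤ 4 * m
    swap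
    · omega
    have e1 := (hp a ha (by omega)).2.2
    have e2 := (hp b (by omega) hb4).2.2
    have hcr := cross_chords x r _ _ _ _ hr (hlt a b hab) (hlt b (p a) hb) (hlt (p a) (p b) hc) (by
      have : ((p b : ℕ) : ℝ) < N := by exact_mod_cast (by omega : p b < N)
      have h0 : (0 : ℝ) ≤ a := by positivity
      have h1 : 2 * Real.pi * (p b : ℕ) / N < 2 * Real.pi := by
        rw [div_lt_iff₀ hNr]; nlinarith
      have h2 : 0 ≤ 2 * Real.pi * a / N := by positivity
      linarith)
    rw [← hang, ← hang, ← hang, ← hang, Set.pair_comm (u (v + (p b : ℕ)))] at hcr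
    rw [hnc _ e1 _ e2 ?_] at hcr
    · exact Set.not_nonempty_empty hcr
    · intro h
      rcases hFne _ _ _ _ h with h | h
      · have := hvinj _ _ (by omega) (by omega) h; omega
      · have := hvinj _ _ (by omega) (by omega) h; omega
  · intro t h1 h2
    by_contra hcon
    obtain ⟨a1, a2, a3⟩ := hp t h1 h2
    have hNm : (N : ℝ) = 4 * m + 1 := by rw [hN]; push_cast; ring
    have ht0 : (1 : ℝ) ≤ t := by exact_mod_cast h1
    have hpt : ((p t : ℕ) : ℝ) ≤ 4 * m := by exact_mod_cast a2
    have hpt2 : (t : ℝ) + 2 * m + 1 ≤ (p t : ℕ) := by exact_mod_cast (by omega : t + 2 * m + 1 ≤ p t)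
    have hcr := cross_radial x r φ (φ + 2 * Real.pi * t / N) (φ + 2 * Real.pi * (p t : ℕ) / N) hr
      (by have : 0 < 2 * Real.pi * t / N := by positivity
          linarith)
      (by have : 2 * Real.pi * t / N < Real.pi := by
            rw [div_lt_iff₀ hNr]; nlinarith
          linarith)
      (by have : 2 * Real.pi * t / N + Real.pi < 2 * Real.pi * (p t : ℕ) / N := by
            rw [lt_div_iff₀ hNr, add_mul, div_mul_cancel₀ _ hNr.ne']; nlinarith
          linarith)
      (by have : 2 * Real.pi * (p t : ℕ) / N < 2 * Real.pi := by
            rw [div_lt_iff₀ hNr]; nlinarith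
          linarith)
    rw [← hang, ← hang, ← hang0] at hcr
    rw [hnc _ hv _ a3 ?_] at hcr
    · exact Set.not_nonempty_empty hcr
    · intro h
      have : x ∈ ({u (v + t), u (v + (p t : ℕ))} : Set Pt) := by rw [← h]; simp
      rcases this with h | h
      · exact hx _ h.symm
      · exact hx _ h.symm
  · intro i j h
    obtain ⟨t, h1, h2, rfl⟩ := hrep i (hnv i j h)
    exact ⟨t, h1, h2, rfl, hpu _ _ _ h (hp t h1 h2).2.2⟩

theorem core {N m K : ℕ} (hN : N = 4 * m + 1) (hm : 1 ≤ m) (hK : K = m + 1) {x : Pt} {r θ : ℝ}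
    (hr : 0 < r) {u : ZMod N → Pt}
    (hu : ∀ j : ℕ, u (j : ZMod N) = circ x r (θ + 2 * Real.pi * j / N))
    (F : Fin K → Set (Set Pt))
    (hpm : ∀ i, IsPerfectMatching (insert x (Set.range u)) (F i))
    (hnc : ∀ i, NonCrossing (F i))
    (hdisj : ∀ i j, i ≠ j → Disjoint (F i) (F j))
    (htf : TriangleFree (⋃ i, F i)) :
    (∀ i, {j : ZMod N | ({u j, u (j + 1)} : Set Pt) ∈ F i}.ncard = 2) ↔
    (∃ a : ZMod N,
      {j : ZMod N | ({x, u j} : Set Pt) ∈ ⋃ i, F i} =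
        {j : ZMod N | ∃ t : ℕ, t < K ∧ j = a + (t : ZMod N)}) := by
  have hNpos : 0 < N := by omega
  have : NeZero N := ⟨hNpos.ne'⟩
  have inj := wheel_inj hNpos hr hu
  have hx := wheel_center hNpos hr hu
  have hz : (4 * (m : ZMod N) + 1) = 0 := by
    have : ((4 * m + 1 : ℕ) : ZMod N) = 0 := by rw [← hN]; simp
    exact_mod_cast this
  choose v p hncm hv hvu hE hE' using fun i => per_matching hN hr hu (hpm i) (hnc i)
  have hdj : ∀ i j e, e ∈ F i → e ∈ F j → i = j := by
    intro i j e h1 h2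
    by_contra h
    exact Set.disjoint_left.1 (hdisj i j h) h1 h2
  have vinj : Function.Injective v := by
    intro i j h
    apply hdj i j _ (hv i)
    rw [h]; exact hv j
  have hrad : {j : ZMod N | ({x, u j} : Set Pt) ∈ ⋃ i, F i} = Set.range v := by
    ext j
    simp only [Set.mem_ofPred_eq, Set.mem_iUnion, Set.mem_range]
    constructor
    · rintro ⟨i, hi⟩; exact ⟨i, (hvu i j hi).symm⟩
    · rintro ⟨i, rfl⟩; exact ⟨i, hv i⟩
  have hbd : ∀ i, {j : ZMod N | ({u j, u (j + 1)} : Set Pt) ∈ F i}.ncard =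
      {t : ℕ | 1 ≤ t ∧ t ≤ 4 * m ∧ p i t = t + 1}.ncard := by
    intro i
    have : {j : ZMod N | ({u j, u (j + 1)} : Set Pt) ∈ F i} =
        (fun t : ℕ => v i + (t : ZMod N)) '' {t : ℕ | 1 ≤ t ∧ t ≤ 4 * m ∧ p i t = t + 1} := by
      ext j
      simp only [Set.mem_ofPred_eq, Set.mem_image]
      constructor
      · intro h
        obtain ⟨t, h1, h2, h3, h4⟩ := hE' i _ _ h
        refine ⟨t, ⟨h1, h2, ?_⟩, h3.symm⟩
        rw [h3, add_assoc] at h4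
        have h5 : ((t + 1 : ℕ) : ZMod N) = (p i t : ℕ) := by
          push_cast; exact add_left_cancel h4
        have h6 := (hncm i).hi t h1 h2
        have h7 := (hncm i).lo t h1 h2
        rcases Nat.lt_or_ge t (4 * m) with h8 | h8
        · exact (cast_inj_lt (by omega) (by omega) h5).symm
        · have h9 : ((p i t : ℕ) : ZMod N) = (0 : ℕ) := by
            rw [← h5, show t + 1 = N by omega]; simp
          have := cast_inj_lt (by omega) (by omega) h9
          omega
      · rintro ⟨t, ⟨h1, h2, h3⟩, rfl⟩
        have := hE i t h1 h2
        rw [h3] at this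
        push_cast at this
        rw [← add_assoc] at this
        exact this
    rw [this]
    apply Set.ncard_image_of_injOn
    intro a ha b hb hab
    exact cast_inj_lt (by have := ha.2.1; omega) (by have := hb.2.1; omega) (add_left_cancel hab)
  have tri : ∀ p q r : Pt, p ≠ q → p ≠ r → q ≠ r → ({p, q} : Set Pt) ∈ ⋃ i, F i →
      ({q, r} : Set Pt) ∈ ⋃ i, F i → ({p, r} : Set Pt) ∈ ⋃ i, F i → False :=
    fun p q r h1 h2 h3 h4 h5 h6 => htf ⟨p, q, r, h1, h2, h3, h4, h5, h6⟩
  rw [hrad]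
  simp only [hbd]
  constructor
  · intro h2
    have hDR : ∀ i, DR m (p i) := fun i => (hncm i).dr_of_two hm (h2 i)
    have E1 : ∀ i (a b : ℕ), 1 ≤ a → 1 ≤ b → a + b = 2 * m + 1 →
        ({u (v i + a), u (v i + b)} : Set Pt) ∈ F i := by
      intro i a b h1 h2 h3
      have := hE i a h1 (by omega)
      rwa [(hDR i).1 a h1 (by omega), show 2 * m + 1 - a = b by omega] at this
    have E2 : ∀ i (a b : ℕ), 2 * m + 1 ≤ a → 2 * m + 1 ≤ b → a + b = 6 * m + 1 →
        ({u (v i + a), u (v i + b)} : Set Pt) ∈ F i := by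
      intro i a b h1 h2 h3
      have := hE i a (by omega) (by omega)
      rwa [(hDR i).2 a h1 (by omega), show 6 * m + 1 - a = b by omega] at this
    let i0 : Fin K := ⟨0, by omega⟩
    set v0 := v i0 with hv0
    let P : ℤ → Prop := fun k => ∃ i, v i = v0 + (k : ZMod N)
    have G1 : ∀ k, P k → ∀ s : ℤ, 0 ≤ s → s < m →
        ({u (v0 + ((k + m - s : ℤ) : ZMod N)), u (v0 + ((k + m + 1 + s : ℤ) : ZMod N))} : Set Pt) ∈ ⋃ i, F i := by
      rintro k ⟨i, hi⟩ s hs0 hs1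
      lift s to ℕ using hs0
      obtain ⟨a, ha⟩ : ∃ a, a + s = m := ⟨m - s, by omega⟩
      have e := E1 i a (m + 1 + s) (by omega) (by omega) (by omega)
      have ha' : (a : ZMod N) + s = m := by exact_mod_cast congrArg (Nat.cast : ℕ → ZMod N) ha
      rw [Set.mem_iUnion]
      refine ⟨i, ?_⟩
      convert e using 3
      · rw [hi]; push_cast; linear_combination -ha'
      · rw [hi]; push_cast; ring
    have G2 : ∀ k, P k → ∀ s : ℤ, 0 ≤ s → s < m →
        ({u (v0 + ((k - m - 1 - s : ℤ) : ZMod N)), u (v0 + ((k - m + s : ℤ) : ZMod N))} : Set Pt) ∈ ⋃ i, F i := by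
      rintro k ⟨i, hi⟩ s hs0 hs1
      lift s to ℕ using hs0
      obtain ⟨a, ha⟩ : ∃ a, a + s = 3 * m := ⟨3 * m - s, by omega⟩
      have e := E2 i a (3 * m + 1 + s) (by omega) (by omega) (by omega)
      have ha' : (a : ZMod N) + s = 3 * m := by exact_mod_cast congrArg (Nat.cast : ℕ → ZMod N) ha
      rw [Set.mem_iUnion]
      refine ⟨i, ?_⟩
      convert e using 3
      · rw [hi]; push_cast; linear_combination -ha' - hz
      · rw [hi]; congr 1; push_cast; linear_combination (-1 : ZMod N) * hz
    let GM : ℤ → Prop := fun z => ∀ s : ℤ, 0 ≤ s → s < m →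
      ({u (v0 + ((z - s : ℤ) : ZMod N)), u (v0 + ((z + 1 + s : ℤ) : ZMod N))} : Set Pt) ∈ ⋃ i, F i
    have M1 : ∀ k, P k → GM (k + m) := fun k hk s h1 h2 => G1 k hk s h1 h2
    have M2 : ∀ k, P k → GM (k - m - 1) := by
      intro k hk s h1 h2
      have := G2 k hk s h1 h2
      rwa [show k - (m : ℤ) - 1 + 1 + s = k - m + s by ring]
    have hdist : ∀ a b : ℤ, 0 < b - a → b - a < 4 * m + 1 →
        u (v0 + ((a : ℤ) : ZMod N)) ≠ u (v0 + ((b : ℤ) : ZMod N)) := by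
      intro a b h1 h2 h3
      have h4 := add_left_cancel (inj h3)
      have h5 : ((b - a : ℤ) : ZMod N) = 0 := by push_cast; rw [h4]; ring
      rw [ZMod.intCast_zmod_eq_zero_iff_dvd] at h5
      have := Int.le_of_dvd h1 h5
      rw [hN] at this
      push_cast at this
      omega
    have TR : ∀ z g h : ℤ, m + 1 ≤ g → m + 1 ≤ h → g + h ≤ 3 * m → GM z → GM (z + g) →
        GM (z + (g + h)) → False := by
      intro z g h hg hh hgh k1 k2 k3
      have a1 := k1 (2 * m - h) (by omega) (by omega)
      have a2 := k2 (g + h - 2 * m - 1) (by omega) (by omega)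
      have a3 := k3 (2 * m - g) (by omega) (by omega)
      rw [show z + g - (g + h - 2 * m - 1) = z + 1 + (2 * m - h) by ring] at a2
      rw [show z + (g + h) - (2 * m - g) = z + g + 1 + (g + h - 2 * m - 1) by ring] at a3
      have hcyc : (((z - (2 * m - h) : ℤ)) : ZMod N) = ((z + (g + h) + 1 + (2 * m - g) : ℤ) : ZMod N) := by
        push_cast; linear_combination -hz
      rw [hcyc, Set.pair_comm] at a1
      refine tri _ _ _ ?_ ?_ ?_ a2 a3 a1
      · apply hdist <;> omega
      · apply hdist <;> omega
      · apply hdist <;> omega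
    have P0 : P 0 := ⟨i0, by simp [hv0]⟩
    have hper : ∀ k, P (k + (4 * m + 1)) ↔ P k := by
      intro k
      have : ((k + (4 * m + 1) : ℤ) : ZMod N) = k := by push_cast; rw [hz]; ring
      show (∃ i, v i = v0 + ((k + (4 * m + 1) : ℤ) : ZMod N)) ↔ _
      rw [this]
    have hrep : ∀ j : ZMod N, ∃ k : ℤ, -(m : ℤ) ≤ k ∧ k ≤ 3 * m ∧ j = v0 + (k : ZMod N) := by
      intro j
      have hlt := ZMod.val_lt (j - v0)
      have he : (((j - v0).val : ℕ) : ZMod N) = j - v0 := ZMod.natCast_zmod_val _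
      by_cases hc : (j - v0).val ≤ 3 * m
      · refine ⟨((j - v0).val : ℕ), by omega, by omega, ?_⟩
        rw [Int.cast_natCast, he]; ring
      · refine ⟨((j - v0).val : ℕ) - (4 * m + 1), by omega, by omega, ?_⟩
        push_cast
        rw [he, hz]; ring
    have hcard : ((Finset.Icc (-(m : ℤ)) (3 * m)).filter P).card = (m : ℤ) + 1 := by
      have e : ((Finset.Icc (-(m : ℤ)) (3 * m)).filter P).image (fun k : ℤ => v0 + (k : ZMod N)) =
          Finset.univ.image v := by
        ext j
        simp only [Finset.mem_image, Finset.mem_filter, Finset.mem_Icc, Finset.mem_univ, true_and]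
        constructor
        · rintro ⟨k, ⟨_, i, hi⟩, rfl⟩; exact ⟨i, hi⟩
        · rintro ⟨i, rfl⟩
          obtain ⟨k, h1, h2, h3⟩ := hrep (v i)
          exact ⟨k, ⟨⟨h1, h2⟩, i, h3⟩, h3.symm⟩
      have e2 := congrArg Finset.card e
      rw [Finset.card_image_of_injective _ vinj, Finset.card_univ, Fintype.card_fin,
        Finset.card_image_of_injOn] at e2
      · rw [e2, hK]; push_cast; ring
      · intro a ha b hb hab
        simp only [Finset.coe_filter, Finset.mem_Icc, Set.mem_ofPred_eq] at ha hb
        by_contra hne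
        rcases lt_or_gt_of_ne hne with h | h
        · exact hdist a b (by omega) (by omega) (congrArg u hab)
        · exact hdist b a (by omega) (by omega) (congrArg u hab.symm)
    have H0 : ∀ k, P k → P (k + 2 * m) → False := by
      rintro k ⟨i, hi⟩ ⟨j, hj⟩
      have e1 := E1 j 1 (2 * m) (by omega) (by omega) (by omega)
      have e2 := E2 i (2 * m + 1) (4 * m) (by omega) (by omega) (by omega)
      have hji : v j = v i + 2 * m := by rw [hi, hj]; push_cast; ring
      have f1 : v j + ((1 : ℕ) : ZMod N) = v i + ((2 * m + 1 : ℕ) : ZMod N) := by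
        rw [hji]; push_cast; ring
      have f2 : v j + ((2 * m : ℕ) : ZMod N) = v i + ((4 * m : ℕ) : ZMod N) := by
        rw [hji]; push_cast; ring
      rw [f1, f2] at e1
      have := hdj _ _ _ e1 e2
      subst this
      refine hdist k (k + 2 * m) (by omega) (by omega) ?_
      rw [← hi, ← hj]
    have H1 : ∀ v g h : ℤ, m + 1 ≤ g → m + 1 ≤ h → g + h ≤ 3 * m → P v → P (v + g) → P (v + (g + h)) → False := by
      intro z g h hg hh hgh p1 p2 p3
      have a1 := M1 _ p1
      have a2 := M1 _ p2
      have a3 := M1 _ p3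
      rw [show z + g + m = z + m + g by ring] at a2
      rw [show z + (g + h) + m = z + m + (g + h) by ring] at a3
      exact TR _ g h hg hh hgh a1 a2 a3
    have H2 : ∀ v g w : ℤ, m + 1 ≤ g → g ≤ 2 * m - 1 → g - m ≤ w → w ≤ m → P v → P (v + g) → P (v + w) → False := by
      intro z g w hg hg2 hw hw2 p1 p2 p3
      by_cases hc : w = g - m
      · have a1 := M2 _ p1
        have a2 := M2 _ p2
        have a3 := M1 _ p3
        rw [show z + g - m - 1 = z - m - 1 + g by ring] at a2
        rw [show z + w + m = z - m - 1 + (g + (w + 2 * m + 1 - g)) by ring] at a3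
        exact TR _ g _ hg (by omega) (by omega) a1 a2 a3
      · have a1 := M2 _ p3
        have a2 := M1 _ p1
        have a3 := M1 _ p2
        rw [show z + m = z + w - m - 1 + (2 * m + 1 - w) by ring] at a2
        rw [show z + g + m = z + w - m - 1 + ((2 * m + 1 - w) + g) by ring] at a3
        exact TR _ _ g (by omega) hg (by omega) a1 a2 a3
    obtain ⟨a, ha⟩ := int_consec (m := (m : ℤ)) (by omega) P hper P0 H0 H1 H2 (by convert hcard)
    · have ha0 := (ha 0 (by omega) (by omega)).1 P0
      refine ⟨v0 + (a : ZMod N), ?_⟩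
      ext j
      simp only [Set.mem_range, Set.mem_ofPred_eq]
      constructor
      · rintro ⟨i, rfl⟩
        obtain ⟨k, h1, h2, h3⟩ := hrep (v i)
        have hk := (ha k h1 h2).1 ⟨i, h3⟩
        refine ⟨(k - a).toNat, by omega, ?_⟩
        have : (((k - a).toNat : ℤ) : ZMod N) = ((k - a : ℤ) : ZMod N) := by
          rw [Int.toNat_of_nonneg (by omega)]
        rw [Int.cast_natCast] at this
        rw [this, h3]; push_cast; ring
      · rintro ⟨t, ht, rfl⟩
        obtain ⟨i, hi⟩ := (ha (a + t) (by omega) (by omega)).2 (by omega)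
        refine ⟨i, ?_⟩
        rw [hi]; push_cast; ring
  · rintro ⟨a, ha⟩ i
    have hi : ∀ w : ℕ, ∃ i, w ≤ m → v i = a + (w : ZMod N) := by
      intro w
      by_cases hw : w ≤ m
      · have : a + (w : ZMod N) ∈ Set.range v := by rw [ha]; exact ⟨w, by omega, rfl⟩
        obtain ⟨i, hi⟩ := this
        exact ⟨i, fun _ => hi⟩
      · exact ⟨i, fun h => absurd h hw⟩
    choose ι hι using hi
    have inV : ∀ s : ℕ, s ≤ m → ({x, u (a + (s : ZMod N))} : Set Pt) ∈ ⋃ i, F i := by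
      intro s hs
      rw [Set.mem_iUnion]
      refine ⟨ι s, ?_⟩
      rw [← hι s hs]; exact hv _
    have inV' : ∀ w, w ≤ m → ∀ t : ℕ, t ≤ 4 * m → (t ≤ m - w ∨ 4 * m + 1 - w ≤ t) →
        ({x, u (v (ι w) + (t : ZMod N))} : Set Pt) ∈ ⋃ i, F i := by
      intro w hw t h1 h2
      rw [hι w hw]
      rcases h2 with h2 | h2
      · have := inV (w + t) (by omega)
        rwa [Nat.cast_add, ← add_assoc] at this
      · obtain ⟨s, hs⟩ : ∃ s, w + t = s + N := ⟨w + t - N, by omega⟩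
        have h3 := inV s (by omega)
        have h4 : (w : ZMod N) + t = s := by
          have := congrArg (Nat.cast : ℕ → ZMod N) hs
          push_cast at this
          simpa using this
        rwa [← h4, ← add_assoc] at h3
    have fam : Fam m (fun w => p (ι w)) := by
      refine ⟨fun w _ => hncm _, ?_, ?_⟩
      · intro w hw t h1 h2 h3
        by_contra hc
        have b1 := (hncm (ι w)).lo t h1 h2
        have b2 := (hncm (ι w)).hi t h1 h2
        have b3 := (hncm (ι w)).ne t h1 h2
        have c1 := inV' w hw t h2 h3
        have c2 := inV' w hw (p (ι w) t) b2 (by omega)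
        refine tri _ _ _ (hx _).symm (hx _).symm ?_ c1 (Set.mem_iUnion.2 ⟨_, hE (ι w) t h1 h2⟩) c2
        intro h
        exact b3 (cast_inj_lt (by omega) (by omega) (add_left_cancel (inj h))).symm
      · intro w w' hw hw' hne t t' h1 h2 h3 h4 h5 h6
        have c1 := hE (ι w) t h1 h2
        have c2 := hE (ι w') t' h3 h4
        rw [hι w hw] at c1
        rw [hι w' hw'] at c2
        rw [← hN] at h5 h6
        have d5 := (ZMod.natCast_eq_natCast_iff _ _ _).2 h5
        have d6 := (ZMod.natCast_eq_natCast_iff _ _ _).2 h6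
        push_cast at d5 d6
        rw [add_assoc, add_assoc, d5, d6] at c1
        rw [add_assoc, add_assoc] at c2
        have e := hdj _ _ _ c1 c2
        have e1 := hι w hw
        rw [e, hι w' hw'] at e1
        exact hne (cast_inj_lt (by omega) (by omega) (add_left_cancel e1)).symm
    have : v i ∈ Set.range v := ⟨i, rfl⟩
    rw [ha] at this
    obtain ⟨w, hw, hvi⟩ := this
    have e : ι w = i := vinj (by rw [hι w (by omega), hvi])
    have := fam.dr w (by omega)
    rw [e] at this
    exact two_of_dr hm this

/-- Let `S` be `2n` points in regular wheel configuration, `n ≥ 3` odd,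
and `k = ⌈n/2⌉ = (n+1)/2`. If `F 1, …, F k` are pairwise edge-disjoint non-crossing perfect
matchings on `S` whose union `G` is triangle-free, then: every `F i` has exactly two
boundary edges iff the circle points incident with radial edges of `G` are `k` consecutive
points on the circle. -/
theorem stmt9 (n : ℕ) (hn : 3 ≤ n) (hodd : Odd n) (x : Pt) (u : ZMod (2 * n - 1) → Pt)
    (hw : RegularWheel n x u)
    (F : Fin ((n + 1) / 2) → Set (Set Pt))
    (hpm : ∀ i, IsPerfectMatching (insert x (Set.range u)) (F i))
    (hnc : ∀ i, NonCrossing (F i))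
    (hdisj : ∀ i j, i ≠ j → Disjoint (F i) (F j))
    (htf : TriangleFree (⋃ i, F i)) :
    (∀ i, {j : ZMod (2 * n - 1) | ({u j, u (j + 1)} : Set Pt) ∈ F i}.ncard = 2) ↔
    (∃ a : ZMod (2 * n - 1),
      {j : ZMod (2 * n - 1) | ({x, u j} : Set Pt) ∈ ⋃ i, F i} =
        {j : ZMod (2 * n - 1) | ∃ t : ℕ, t < (n + 1) / 2 ∧ j = a + (t : ZMod (2 * n - 1))}) := by
  obtain ⟨m, hm⟩ := hodd
  obtain ⟨r, θ, hr, h⟩ := hw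
  exact core (N := 2 * n - 1) (m := m) (K := (n + 1) / 2) (by omega) (by omega) (by omega) hr
    (wheel_nat (n := n) rfl hn h) F hpm hnc hdisj htf
end
end

section
/- Let S be a set of 2n points in general position in the plane, where n = 2^k + h with 0 ≤ h < 2^k. Then there exist at least k pairwise edge-disjoint non-crossing perfect matchings F_1, F_2, …, F_k on S such that the union F_1 ∪ … ∪ F_k is a triangle-free geometric graph. -/
noncomputable section

open Classical

lemma openSeg_pair {a b x : Pt} (h : x ∈ openSeg {a, b}) : x ∈ openSegment ℝ a b := by
  obtain ⟨c, hc, d, hd, hne, hx⟩ := h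
  simp only [Set.mem_insert_iff, Set.mem_singleton_iff] at hc hd
  rcases hc with rfl | rfl <;> rcases hd with rfl | rfl
  · exact absurd rfl hne
  · exact hx
  · rw [openSegment_symm]; exact hx
  · exact absurd rfl hne

lemma union_pm {A B : Set Pt} {F G : Set (Set Pt)} (hF : IsPerfectMatching A F)
    (hG : IsPerfectMatching B G) (hAB : Disjoint A B) : IsPerfectMatching (A ∪ B) (F ∪ G) := by
  have sub : ∀ {A : Set Pt} {F : Set (Set Pt)}, IsPerfectMatching A F →
      ∀ e ∈ F, ∀ p ∈ e, p ∈ A := by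
    intro A F h e he p hp
    obtain ⟨a, b, -, ha, hb, rfl⟩ := h.1 e he
    rcases hp with rfl | rfl <;> assumption
  rw [Set.disjoint_left] at hAB
  refine ⟨?_, ?_⟩
  · rintro e (he | he)
    · obtain ⟨a, b, h, ha, hb, rfl⟩ := hF.1 e he
      exact ⟨a, b, h, Or.inl ha, Or.inl hb, rfl⟩
    · obtain ⟨a, b, h, ha, hb, rfl⟩ := hG.1 e he
      exact ⟨a, b, h, Or.inr ha, Or.inr hb, rfl⟩
  · rintro p (hp | hp)
    · obtain ⟨e, ⟨he, hpe⟩, hu⟩ := hF.2 p hp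
      refine ⟨e, ⟨Or.inl he, hpe⟩, ?_⟩
      rintro e' ⟨he' | he', hpe'⟩
      · exact hu _ ⟨he', hpe'⟩
      · exact absurd (sub hG _ he' _ hpe') (hAB hp)
    · obtain ⟨e, ⟨he, hpe⟩, hu⟩ := hG.2 p hp
      refine ⟨e, ⟨Or.inr he, hpe⟩, ?_⟩
      rintro e' ⟨he' | he', hpe'⟩
      · exact absurd hp (hAB (sub hF _ he' _ hpe'))
      · exact hu _ ⟨he', hpe'⟩

lemma sep_nc (f : Pt →ₗ[ℝ] ℝ) {A B : Set Pt} {e e' : Set Pt} (he : IsEdgeOn A e)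
    (he' : IsEdgeOn B e') (hs : ∀ a ∈ A, ∀ b ∈ B, f a < f b) : openSeg e ∩ openSeg e' = ∅ := by
  obtain ⟨a, b, -, ha, hb, rfl⟩ := he
  obtain ⟨c, d, -, hc, hd, rfl⟩ := he'
  rw [Set.eq_empty_iff_forall_notMem]
  rintro x ⟨hx, hx'⟩
  obtain ⟨s, t, hs0, ht0, hst, rfl⟩ := openSeg_pair hx
  obtain ⟨s', t', hs0', ht0', hst', hh⟩ := openSeg_pair hx'
  have h := congrArg f hh
  simp only [map_add, map_smul, smul_eq_mul] at h
  have h1 := hs a ha c hc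
  have h2 := hs a ha d hd
  have h3 := hs b hb c hc
  have h4 := hs b hb d hd
  obtain ⟨m, hm⟩ : ∃ m, m = min (f c) (f d) := ⟨_, rfl⟩
  have m1 : f a < m := by rw [hm]; exact lt_min h1 h2
  have m2 : f b < m := by rw [hm]; exact lt_min h3 h4
  have m3 : m ≤ f c := by rw [hm]; exact min_le_left _ _
  have m4 : m ≤ f d := by rw [hm]; exact min_le_right _ _
  have e1 : s * f a + t * f b < m := by
    have : m = s * m + t * m := by rw [← add_mul, hst, one_mul]
    rw [this]; gcongr
  have e2 : m ≤ s' * f c + t' * f d := by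
    have : m = s' * m + t' * m := by rw [← add_mul, hst', one_mul]
    rw [this]; gcongr
  linarith

lemma union_nc (f : Pt →ₗ[ℝ] ℝ) {A B : Set Pt} {F G : Set (Set Pt)}
    (hF : ∀ e ∈ F, IsEdgeOn A e) (hG : ∀ e ∈ G, IsEdgeOn B e)
    (hs : ∀ a ∈ A, ∀ b ∈ B, f a < f b) (nF : NonCrossing F) (nG : NonCrossing G) :
    NonCrossing (F ∪ G) := by
  rintro e (he | he) e' (he' | he') hne
  · exact nF e he e' he' hne
  · exact sep_nc f (hF e he) (hG e' he') hs
  · rw [Set.inter_comm]; exact sep_nc f (hF e' he') (hG e he) hs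
  · exact nG e he e' he' hne

/-- Euclidean distance. -/
def ed (p q : Pt) : ℝ := dist (Complex.equivRealProdLm.symm p) (Complex.equivRealProdLm.symm q)

lemma ed_tri (a x b : Pt) : ed a b ≤ ed a x + ed x b := dist_triangle _ _ _

lemma ed_comm (a b : Pt) : ed a b = ed b a := dist_comm _ _

lemma ed_eq {a x b : Pt} (h : Wbtw ℝ a x b) : ed a x + ed x b = ed a b := by
  apply Wbtw.dist_add_dist
  exact h.map (Complex.equivRealProdLm.symm.toLinearMap.toAffineMap)

lemma ed_wbtw {a x b : Pt} (h : ed a x + ed x b = ed a b) : Wbtw ℝ a x b := by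
  have := dist_add_dist_eq_iff.1 h
  have := this.map (Complex.equivRealProdLm.toLinearMap.toAffineMap)
  simpa using this

lemma cross_lt {a b a' b' x : Pt} (hnc : ¬ Collinear ℝ ({a, b, b'} : Set Pt)) (hab : a ≠ b)
    (hx : x ∈ openSegment ℝ a b) (hx' : x ∈ openSegment ℝ a' b') :
    ed a b' + ed a' b < ed a b + ed a' b' := by
  have w1 : Wbtw ℝ a x b := mem_segment_iff_wbtw.1 (openSegment_subset_segment _ _ _ hx)
  have w2 : Wbtw ℝ a' x b' := mem_segment_iff_wbtw.1 (openSegment_subset_segment _ _ _ hx')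
  have e1 := ed_eq w1
  have e2 := ed_eq w2
  have t1 := ed_tri a x b'
  have t2 := ed_tri a' x b
  have hxa : x ≠ a := by
    rintro rfl
    exact hab (by simpa using hx)
  by_contra hcon
  have e3 : ed a x + ed x b' = ed a b' := by linarith
  have w3 := ed_wbtw e3
  apply hnc
  have c1 : Collinear ℝ ({x, a, b} : Set Pt) := by
    rw [Set.insert_comm]; exact w1.collinear
  have c2 : Collinear ℝ ({x, a, b'} : Set Pt) := by
    rw [Set.insert_comm]; exact w3.collinear
  have h1 : b ∈ line[ℝ, x, a] := c1.mem_affineSpan_of_mem_of_ne (by simp) (by simp) (by simp) hxa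
  have h2 : b' ∈ line[ℝ, x, a] := c2.mem_affineSpan_of_mem_of_ne (by simp) (by simp) (by simp) hxa
  exact collinear_triple_of_mem_affineSpan_pair (right_mem_affineSpan_pair ℝ x a) h1 h2

lemma cross_pm (A B : Finset Pt) (hc : A.card = B.card) (hd : Disjoint A B)
    (hg : GenPos ((A : Set Pt) ∪ B)) :
    ∃ F, IsPerfectMatching ((A : Set Pt) ∪ B) F ∧ NonCrossing F ∧
      ∀ e ∈ F, ∃ a ∈ A, ∃ b ∈ B, e = {a, b} := by
  have : Nonempty (A ≃ B) := ⟨Finset.equivOfCardEq hc⟩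
  obtain ⟨σ, hσ⟩ := Finite.exists_min (fun σ : A ≃ B => ∑ a : A, ed a (σ a))
  have hdj : ∀ a ∈ A, ∀ b ∈ B, a ≠ b := fun a ha b hb h =>
    Finset.disjoint_left.1 hd ha (h ▸ hb)
  refine ⟨{e | ∃ a : A, e = {(a : Pt), (σ a : Pt)}}, ⟨?_, ?_⟩, ?_, ?_⟩
  · rintro e ⟨a, rfl⟩
    exact ⟨a, σ a, hdj _ a.2 _ (σ a).2, Or.inl a.2, Or.inr (σ a).2, rfl⟩
  · rintro p (hp | hp)
    · refine ⟨{p, (σ ⟨p, hp⟩ : Pt)}, ⟨⟨⟨p, hp⟩, rfl⟩, by simp⟩, ?_⟩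
      rintro e ⟨⟨a, rfl⟩, h | h⟩
      · subst h; rfl
      · exact absurd h (hdj _ hp _ (σ a).2)
    · refine ⟨{(σ.symm ⟨p, hp⟩ : Pt), p}, ⟨⟨σ.symm ⟨p, hp⟩, by simp⟩, by simp⟩, ?_⟩
      rintro e ⟨⟨a, rfl⟩, h | h⟩
      · exact absurd h.symm (hdj _ a.2 _ hp)
      · have h : p = σ a := h
        subst h; simp
  · rintro e ⟨a, rfl⟩ e' ⟨a', rfl⟩ hne
    rw [Set.eq_empty_iff_forall_notMem]
    rintro x ⟨hx, hx'⟩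
    have haa : a ≠ a' := by rintro rfl; exact hne rfl
    have hbb : (σ a : Pt) ≠ σ a' := fun h => haa (σ.injective (Subtype.ext h))
    have hlt := cross_lt (hg a (Or.inl a.2) (σ a) (Or.inr (σ a).2) (σ a') (Or.inr (σ a').2)
      (hdj _ a.2 _ (σ a).2) (hdj _ a.2 _ (σ a').2) hbb) (hdj _ a.2 _ (σ a).2)
      (openSeg_pair hx) (openSeg_pair hx')
    have hm := hσ ((Equiv.swap a a').trans σ)
    have split : ∀ g : A → ℝ, ∑ i, g i = g a + (g a' + ∑ i ∈ (Finset.univ.erase a).erase a', g i) := by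
      intro g
      rw [← Finset.add_sum_erase _ g (Finset.mem_univ a),
        ← Finset.add_sum_erase _ g (Finset.mem_erase.2 ⟨haa.symm, Finset.mem_univ a'⟩)]
    rw [split, split] at hm
    have hr : ∑ i ∈ (Finset.univ.erase a).erase a', ed i (((Equiv.swap a a').trans σ) i)
        = ∑ i ∈ (Finset.univ.erase a).erase a', ed i (σ i) := by
      apply Finset.sum_congr rfl
      intro i hi
      simp only [Finset.mem_erase] at hi
      rw [Equiv.trans_apply, Equiv.swap_apply_of_ne_of_ne hi.2.1 hi.1]
    rw [hr] at hm
    simp only [Equiv.trans_apply, Equiv.swap_apply_left, Equiv.swap_apply_right] at hm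
    linarith
  · rintro e ⟨a, rfl⟩
    exact ⟨a, a.2, σ a, (σ a).2, rfl⟩

lemma split_low (f : Pt →ₗ[ℝ] ℝ) (S : Finset Pt) (hf : Set.InjOn f S) (m : ℕ) (hm : m ≤ S.card) :
    ∃ L ⊆ S, L.card = m ∧ ∀ a ∈ L, ∀ b ∈ S \ L, f a < f b := by
  induction m with
  | zero => exact ⟨∅, by simp, by simp, by simp⟩
  | succ m ih =>
    obtain ⟨L, hL, hc, hs⟩ := ih (by omega)
    have hne : (S \ L).Nonempty := by
      rw [← Finset.card_pos, Finset.card_sdiff_of_subset hL]; omega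
    obtain ⟨c, hcm, hmin⟩ := Finset.exists_min_image (S \ L) f hne
    have hcm' := Finset.mem_sdiff.1 hcm
    refine ⟨insert c L, Finset.insert_subset hcm'.1 hL, by
      rw [Finset.card_insert_of_notMem hcm'.2, hc], ?_⟩
    intro a ha b hb
    simp only [Finset.mem_sdiff, Finset.mem_insert, not_or] at hb
    have hb' : b ∈ S \ L := Finset.mem_sdiff.2 ⟨hb.1, hb.2.2⟩
    rcases Finset.mem_insert.1 ha with rfl | ha
    · exact lt_of_le_of_ne (hmin b hb') fun h => hb.2.1 (hf hcm'.1 hb.1 h).symm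
    · exact hs a ha b hb'

/-- `p, q` are the two lowest points. -/
def Low (f : Pt →ₗ[ℝ] ℝ) (S : Finset Pt) (p q : Pt) : Prop :=
  p ∈ S ∧ q ∈ S ∧ p ≠ q ∧ ∀ r ∈ S, r ≠ p → r ≠ q → f p < f r ∧ f q < f r

lemma low_exists (f : Pt →ₗ[ℝ] ℝ) (S : Finset Pt) (hf : Set.InjOn f S) (hm : 2 ≤ S.card) :
    ∃ p q, Low f S p q := by
  obtain ⟨L, hL, hc, hs⟩ := split_low f S hf 2 hm
  obtain ⟨p, q, hpq, rfl⟩ := Finset.card_eq_two.1 hc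
  refine ⟨p, q, hL (by simp), hL (by simp), hpq, fun r hr h1 h2 => ?_⟩
  have : r ∈ S \ {p, q} := by simp [hr, h1, h2]
  exact ⟨hs p (by simp) r this, hs q (by simp) r this⟩

lemma low_mem {f : Pt →ₗ[ℝ] ℝ} {S L : Finset Pt} {p q : Pt} (h : Low f S p q) (hL : L ⊆ S)
    (hc : 2 ≤ L.card) (hs : ∀ a ∈ L, ∀ b ∈ S \ L, f a < f b) : Low f L p q := by
  have key : ∀ p q, Low f S p q → p ∈ L := by
    intro p q h
    by_contra hp
    have : L ⊆ {q} := by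
      intro a ha
      have h1 := hs a ha p (Finset.mem_sdiff.2 ⟨h.1, hp⟩)
      by_contra haq
      have := h.2.2.2 a (hL ha) (fun e => hp (e ▸ ha)) (by simpa using haq)
      linarith
    have := Finset.card_le_card this
    simp at this; omega
  refine ⟨key p q h, key q p ⟨h.2.1, h.1, h.2.2.1.symm, fun r hr a b =>
    (h.2.2.2 r hr b a).symm⟩, h.2.2.1, fun r hr => h.2.2.2 r (hL hr)⟩

/-- the first matching -/
lemma first (f : Pt →ₗ[ℝ] ℝ) (k : ℕ) (S : Finset Pt) (hf : Set.InjOn f S)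
    (hg : GenPos (S : Set Pt)) (n : ℕ) (hc : S.card = 2 * n) (hk : 2 * 2 ^ k ≤ n) :
    ∃ L R : Finset Pt, ∃ u v F, L ⊆ S ∧ R = S \ L ∧ (∀ a ∈ L, ∀ b ∈ R, f a < f b) ∧
      (∃ m, L.card = 2 * m ∧ 2 ^ k ≤ m) ∧ (∃ m, R.card = 2 * m ∧ 2 ^ k ≤ m) ∧
      Low (-f) R u v ∧ IsPerfectMatching (S : Set Pt) F ∧ NonCrossing F ∧
      ∀ e ∈ F, (∃ a ∈ L, ∃ b ∈ R, e = {a, b}) ∨ e = {u, v} := by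
  have h1 : 1 ≤ 2 ^ k := Nat.one_le_two_pow
  have hninj : ∀ T ⊆ S, Set.InjOn (-f) T := fun T hT a ha b hb h =>
    hf (hT ha) (hT hb) (by simpa using h)
  rcases Nat.even_or_odd' n with ⟨m, rfl | rfl⟩
  · obtain ⟨L, hL, hLc, hs⟩ := split_low f S hf (2 * m) (by omega)
    have hRc : (S \ L).card = 2 * m := by rw [Finset.card_sdiff_of_subset hL]; omega
    obtain ⟨u, v, huv⟩ := low_exists (-f) (S \ L) (hninj _ Finset.sdiff_subset) (by omega)
    have hU : (L : Set Pt) ∪ ((S \ L : Finset Pt) : Set Pt) = S := by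
      rw [← Finset.coe_union, Finset.union_sdiff_of_subset hL]
    obtain ⟨F, hF1, hF2, hF3⟩ := cross_pm L (S \ L) (by omega) Finset.disjoint_sdiff
      (by rw [hU]; exact hg)
    rw [hU] at hF1
    exact ⟨L, S \ L, u, v, F, hL, rfl, hs, ⟨m, hLc, by omega⟩, ⟨m, hRc, by omega⟩, huv, hF1, hF2,
      fun e he => Or.inl (hF3 e he)⟩
  · obtain ⟨L, hL, hLc, hs⟩ := split_low f S hf (2 * m) (by omega)
    have hRc : (S \ L).card = 2 * (m + 1) := by rw [Finset.card_sdiff_of_subset hL]; omega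
    obtain ⟨u, v, huv⟩ := low_exists (-f) (S \ L) (hninj _ Finset.sdiff_subset) (by omega)
    have huvR : {u, v} ⊆ S \ L := by
      intro x hx
      simp only [Finset.mem_insert, Finset.mem_singleton] at hx
      rcases hx with rfl | rfl
      exacts [huv.1, huv.2.1]
    have huvL : ∀ x ∈ ({u, v} : Finset Pt), x ∉ L := fun x hx => (Finset.mem_sdiff.1 (huvR hx)).2
    have hRc' : ((S \ L) \ {u, v}).card = 2 * m := by
      rw [Finset.card_sdiff_of_subset huvR, Finset.card_pair huv.2.2.1]; omega
    have hU : (L : Set Pt) ∪ (((S \ L) \ {u, v} : Finset Pt) : Set Pt) ⊆ S := by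
      rw [← Finset.coe_union, Finset.coe_subset]
      exact Finset.union_subset hL (Finset.sdiff_subset.trans Finset.sdiff_subset)
    obtain ⟨F, hF1, hF2, hF3⟩ := cross_pm L ((S \ L) \ {u, v}) (by omega)
      (Finset.disjoint_sdiff.mono_right Finset.sdiff_subset)
      (fun p hp q hq r hr => hg p (hU hp) q (hU hq) r (hU hr))
    have hP : IsPerfectMatching ({u, v} : Set Pt) {{u, v}} := by
      refine ⟨?_, ?_⟩
      · rintro e rfl
        exact ⟨u, v, huv.2.2.1, by simp, by simp, rfl⟩
      · intro p hp
        exact ⟨{u, v}, ⟨rfl, hp⟩, fun e he => he.1⟩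
    have hN : NonCrossing ({{u, v}} : Set (Set Pt)) := by
      rintro e rfl e' rfl h; exact absurd rfl h
    have huvS : ∀ x ∈ ({u, v} : Set Pt), x ∈ S \ L := fun x hx => huvR (by simpa using hx)
    refine ⟨L, S \ L, u, v, F ∪ {{u, v}}, hL, rfl, hs, ⟨m, hLc, by omega⟩, ⟨m + 1, hRc, by omega⟩,
      huv, ?_, ?_, ?_⟩
    · have := union_pm hF1 hP (by
        rw [Set.disjoint_left]
        rintro x (hx | hx) hx'
        · exact huvL x (by simpa using hx') hx
        · rw [Finset.mem_coe, Finset.mem_sdiff] at hx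
          exact hx.2 (by simpa using hx'))
      convert this using 1
      ext x
      have := huvS x
      have := @hL x
      simp only [Set.mem_union, Finset.mem_coe, Finset.mem_sdiff, Set.mem_insert_iff,
        Set.mem_singleton_iff, Finset.mem_insert, Finset.mem_singleton] at *
      tauto
    · refine union_nc f hF1.1 hP.1 ?_ hF2 hN
      rintro a (ha | ha) b hb
      · exact hs a ha b (huvS b hb)
      · rw [Finset.mem_coe, Finset.mem_sdiff] at ha
        simp only [Finset.mem_insert, Finset.mem_singleton, not_or] at ha
        have := huv.2.2.2 a ha.1 ha.2.1 ha.2.2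
        simp only [LinearMap.neg_apply] at this
        rcases hb with rfl | rfl <;> linarith
    · rintro e (he | he)
      · obtain ⟨a, ha, b, hb, rfl⟩ := hF3 e he
        exact Or.inl ⟨a, ha, b, (Finset.mem_sdiff.1 hb).1, rfl⟩
      · exact Or.inr he

lemma pm_mem {A : Set Pt} {F : Set (Set Pt)} (h : IsPerfectMatching A F) {e : Set Pt}
    (he : e ∈ F) {p : Pt} (hp : p ∈ e) : p ∈ A := by
  obtain ⟨a, b, -, ha, hb, rfl⟩ := h.1 e he
  rcases hp with rfl | rfl <;> assumption

lemma pm_uniq {A : Set Pt} {F : Set (Set Pt)} (h : IsPerfectMatching A F) {x y z : Pt}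
    (hy : ({x, y} : Set Pt) ∈ F) (hz : ({x, z} : Set Pt) ∈ F) (hxy : x ≠ y) : y = z := by
  obtain ⟨e, -, hu⟩ := h.2 x (pm_mem h hy (by simp))
  have e1 := hu _ ⟨hy, by simp⟩
  have e2 := hu _ ⟨hz, by simp⟩
  have : y ∈ ({x, z} : Set Pt) := by rw [e2, ← e1]; simp
  rcases this with h | h
  · exact absurd h.symm hxy
  · exact h

set_option maxHeartbeats 1000000 in
lemma main (k : ℕ) : ∀ (f : Pt →ₗ[ℝ] ℝ) (S : Finset Pt) (_ : Set.InjOn f S)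
    (_ : GenPos (S : Set Pt)) (n : ℕ) (_ : S.card = 2 * n) (_ : 2 ^ k ≤ n) (p q : Pt)
    (_ : Low f S p q), ∃ F : Fin k → Set (Set Pt),
      (∀ i, IsPerfectMatching (S : Set Pt) (F i)) ∧
      (∀ i, NonCrossing (F i)) ∧
      (∀ i j, i ≠ j → Disjoint (F i) (F j)) ∧
      TriangleFree (⋃ i, F i) ∧ ({p, q} : Set Pt) ∉ (⋃ i, F i) ∧
      ∀ r, ({p, r} : Set Pt) ∈ (⋃ i, F i) → ({q, r} : Set Pt) ∈ (⋃ i, F i) → False := by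
  induction k with
  | zero =>
    intro f S _ _ n _ _ p q _
    refine ⟨fun _ => ∅, fun i => i.elim0, fun i => i.elim0, fun i => i.elim0, ?_, ?_, ?_⟩
    · simp [TriangleFree]
    · simp
    · simp
  | succ k ih =>
    intro f S hf hg n hc hk p q hpq
    obtain ⟨L, R, u, v, F, hL, hR, hs, ⟨m, hm, hkm⟩, ⟨m', hm', hkm'⟩, huv, hF1, hF2, hF3⟩ :=
      first f k S hf hg n hc (by rw [pow_succ] at hk; omega)
    have h1 : 1 ≤ 2 ^ k := Nat.one_le_two_pow
    have hRS : R ⊆ S := by rw [hR]; exact Finset.sdiff_subset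
    have hpqL := low_mem hpq hL (by omega) (by rw [← hR]; exact hs)
    have hU : (S : Set Pt) = (L : Set Pt) ∪ R := by
      rw [← Finset.coe_union, hR, Finset.union_sdiff_of_subset hL]
    have hLR : ∀ x ∈ L, x ∉ R := fun x hx hx' => lt_irrefl _ (hs x hx x hx')
    obtain ⟨G, G1, G2, G3, G4, G5, G6⟩ := ih f L (hf.mono hL)
      (fun a ha b hb c hc => hg a (hL ha) b (hL hb) c (hL hc)) m hm hkm p q hpqL
    obtain ⟨H, H1, H2, H3, H4, H5, H6⟩ := ih (-f) R
      (fun a ha b hb h => hf (hRS ha) (hRS hb) (by simpa using h))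
      (fun a ha b hb c hc => hg a (hRS ha) b (hRS hb) c (hRS hc)) m' hm' hkm' u v huv
    -- adjacency relations
    have sF : ∀ x y, ({x, y} : Set Pt) ∈ F → ({y, x} : Set Pt) ∈ F := fun x y h => by
      rwa [Set.pair_comm]
    have sG : ∀ x y, ({x, y} : Set Pt) ∈ (⋃ i, G i) → ({y, x} : Set Pt) ∈ (⋃ i, G i) :=
      fun x y h => by rwa [Set.pair_comm]
    have sH : ∀ x y, ({x, y} : Set Pt) ∈ (⋃ i, H i) → ({y, x} : Set Pt) ∈ (⋃ i, H i) :=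
      fun x y h => by rwa [Set.pair_comm]
    have mG : ∀ x y, ({x, y} : Set Pt) ∈ (⋃ i, G i) → x ∈ L ∧ y ∈ L := by
      intro x y h
      obtain ⟨i, hi⟩ := Set.mem_iUnion.1 h
      exact ⟨pm_mem (G1 i) hi (by simp), pm_mem (G1 i) hi (by simp)⟩
    have mH : ∀ x y, ({x, y} : Set Pt) ∈ (⋃ i, H i) → x ∈ R ∧ y ∈ R := by
      intro x y h
      obtain ⟨i, hi⟩ := Set.mem_iUnion.1 h
      exact ⟨pm_mem (H1 i) hi (by simp), pm_mem (H1 i) hi (by simp)⟩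
    have mF : ∀ x y, ({x, y} : Set Pt) ∈ F →
        (x ∈ L ∧ y ∈ R) ∨ (x ∈ R ∧ y ∈ L) ∨ (x = u ∧ y = v) ∨ (x = v ∧ y = u) := by
      intro x y h
      rcases hF3 _ h with ⟨a, ha, b, hb, h⟩ | h
      · rcases Set.pair_eq_pair_iff.1 h with ⟨rfl, rfl⟩ | ⟨rfl, rfl⟩ <;> tauto
      · rcases Set.pair_eq_pair_iff.1 h with ⟨rfl, rfl⟩ | ⟨rfl, rfl⟩ <;> tauto
    have uF : ∀ x y z, ({x, y} : Set Pt) ∈ F → ({x, z} : Set Pt) ∈ F → x ≠ y → y = z :=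
      fun x y z => pm_uniq hF1
    have huR := huv.1
    have hvR := huv.2.1
    have dF : ∀ i, Disjoint F (G i ∪ H i) := by
      intro i
      rw [Set.disjoint_left]
      rintro e he (h | h)
      · obtain ⟨a, b, -, ha, hb, rfl⟩ := (G1 i).1 e h
        rcases mF a b he with c | c | c | c
        · exact hLR _ hb c.2
        · exact hLR _ ha c.1
        · exact hLR _ ha (c.1 ▸ huR)
        · exact hLR _ ha (c.1 ▸ hvR)
      · obtain ⟨a, b, -, ha, hb, rfl⟩ := (H1 i).1 e h
        have h' : ({a, b} : Set Pt) ∈ ⋃ i, H i := Set.mem_iUnion.2 ⟨i, h⟩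
        rcases mF a b he with c | c | ⟨rfl, rfl⟩ | ⟨rfl, rfl⟩
        · exact hLR _ c.1 ha
        · exact hLR _ c.2 hb
        · exact H5 h'
        · exact H5 (sH _ _ h')
    have dGH : ∀ i j, i ≠ j → Disjoint (G i ∪ H i) (G j ∪ H j) := by
      intro i j hij
      have x1 : ∀ i j, Disjoint (G i) (H j) := by
        intro i j
        rw [Set.disjoint_left]
        intro e h h'
        obtain ⟨a, b, -, ha, hb, rfl⟩ := (G1 i).1 e h
        exact hLR a ha (pm_mem (H1 j) h' (by simp))
      simp only [Set.disjoint_union_left, Set.disjoint_union_right]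
      exact ⟨⟨G3 i j hij, (x1 j i).symm⟩, ⟨x1 i j, H3 i j hij⟩⟩
    obtain ⟨K, hK⟩ : ∃ K : Fin (k + 1) → Set (Set Pt), K = Fin.cons F (fun i => G i ∪ H i) :=
      ⟨_, rfl⟩
    have K0 : K 0 = F := by rw [hK]; rfl
    have Ks : ∀ i : Fin k, K i.succ = G i ∪ H i := by intro i; rw [hK]; rfl
    have KU : ∀ e, e ∈ (⋃ i, K i) ↔ e ∈ F ∨ e ∈ (⋃ i, G i) ∨ e ∈ (⋃ i, H i) := by
      intro e
      simp only [Set.mem_iUnion, Fin.exists_fin_succ, K0, Ks, Set.mem_union, exists_or]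
    refine ⟨K, ?_, ?_, ?_, ?_, ?_, ?_⟩
    · intro i
      refine Fin.cases ?_ (fun i => ?_) i
      · rw [K0]; exact hF1
      · rw [Ks, hU]
        exact union_pm (G1 i) (H1 i) (Set.disjoint_left.2 hLR)
    · intro i
      refine Fin.cases ?_ (fun i => ?_) i
      · rw [K0]; exact hF2
      · rw [Ks]
        exact union_nc f (G1 i).1 (H1 i).1 hs (G2 i) (H2 i)
    · intro i j
      refine Fin.cases ?_ (fun i => ?_) i <;> refine Fin.cases ?_ (fun j => ?_) j
      · intro h; exact absurd rfl h
      · intro _; rw [K0, Ks]; exact dF j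
      · intro _; rw [K0, Ks]; exact (dF i).symm
      · intro h; rw [Ks, Ks]; exact dGH i j (fun e => h (by rw [e]))
    · rintro ⟨x, y, z, hxy, hxz, hyz, h1, h2, h3⟩
      have G4' : ∀ x y z, x ≠ y → x ≠ z → y ≠ z → ({x, y} : Set Pt) ∈ (⋃ i, G i) →
        ({y, z} : Set Pt) ∈ (⋃ i, G i) → ({x, z} : Set Pt) ∈ (⋃ i, G i) → False :=
        fun x y z a b c d e f => G4 ⟨x, y, z, a, b, c, d, e, f⟩
      have H4' : ∀ x y z, x ≠ y → x ≠ z → y ≠ z → ({x, y} : Set Pt) ∈ (⋃ i, H i) →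
        ({y, z} : Set Pt) ∈ (⋃ i, H i) → ({x, z} : Set Pt) ∈ (⋃ i, H i) → False :=
        fun x y z a b c d e f => H4 ⟨x, y, z, a, b, c, d, e, f⟩
      rw [KU] at h1 h2 h3
      -- no two F edges share a vertex; a lone F edge is {u, v}
      have key : ∀ x y z, x ≠ y → x ≠ z → y ≠ z → ({x, y} : Set Pt) ∈ F →
          (({x, z} : Set Pt) ∈ F ∨ ({x, z} : Set Pt) ∈ (⋃ i, G i) ∨ ({x, z} : Set Pt) ∈ (⋃ i, H i)) →
          (({y, z} : Set Pt) ∈ F ∨ ({y, z} : Set Pt) ∈ (⋃ i, G i) ∨ ({y, z} : Set Pt) ∈ (⋃ i, H i)) →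
          False := by
        intro x y z hxy hxz hyz h1 h2 h3
        rcases h2 with h2 | h2
        · exact hyz (uF x y z h1 h2 hxy)
        rcases h3 with h3 | h3
        · exact hxz (uF y x z (sF _ _ h1) h3 hxy.symm)
        have c := mF x y h1
        rcases h2 with h2 | h2 <;> rcases h3 with h3 | h3
        · have g1 := (mG _ _ h2).1
          have g2 := (mG _ _ h3).1
          rcases c with c | c | c | c
          · exact hLR _ g2 c.2
          · exact hLR _ g1 c.1
          · exact hLR _ g1 (c.1 ▸ huR)
          · exact hLR _ g1 (c.1 ▸ hvR)
        · exact hLR _ (mG _ _ h2).2 (mH _ _ h3).2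
        · exact hLR _ (mG _ _ h3).2 (mH _ _ h2).2
        · have g1 := (mH _ _ h2).1
          have g2 := (mH _ _ h3).1
          rcases c with c | c | ⟨rfl, rfl⟩ | ⟨rfl, rfl⟩
          · exact hLR _ c.1 g1
          · exact hLR _ c.2 g2
          · exact H6 z h2 h3
          · exact H6 z h3 h2
      have cc : ∀ x y : Pt, ({x, y} : Set Pt) = {y, x} := fun x y => Set.pair_comm x y
      rcases h1 with h1 | h1
      · exact key x y z hxy hxz hyz h1 h3 h2
      rcases h2 with h2 | h2
      · refine key y z x hyz hxy.symm hxz.symm h2 ?_ ?_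
        · rw [cc y x]; exact Or.inr h1
        · rw [cc z x]; exact h3
      rcases h3 with h3 | h3
      · refine key x z y hxz hxy hyz.symm h3 (Or.inr h1) ?_
        rw [cc z y]; exact Or.inr h2
      rcases h1 with h1 | h1
      · rcases h2 with h2 | h2
        · rcases h3 with h3 | h3
          · exact G4' x y z hxy hxz hyz h1 h2 h3
          · exact hLR _ (mG _ _ h1).1 (mH _ _ h3).1
        · exact hLR _ (mG _ _ h1).2 (mH _ _ h2).1
      · rcases h2 with h2 | h2
        · exact hLR _ (mG _ _ h2).1 (mH _ _ h1).2
        · rcases h3 with h3 | h3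
          · exact hLR _ (mG _ _ h3).1 (mH _ _ h1).1
          · exact H4' x y z hxy hxz hyz h1 h2 h3
    · rw [KU]
      have hp := hpqL.1
      have hq := hpqL.2.1
      rintro (h | h | h)
      · rcases mF p q h with c | c | c | c
        · exact hLR _ hq c.2
        · exact hLR _ hp c.1
        · exact hLR _ hp (c.1 ▸ huR)
        · exact hLR _ hp (c.1 ▸ hvR)
      · exact G5 h
      · exact hLR _ hp (mH _ _ h).1
    · intro r h1 h2
      rw [KU] at h1 h2
      have hp := hpqL.1
      have hq := hpqL.2.1
      have hne := hpqL.2.2.1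
      have toR : ∀ x ∈ L, ({x, r} : Set Pt) ∈ F → r ∈ R := by
        intro x hx h
        rcases mF x r h with c | c | c | c
        · exact c.2
        · exact absurd c.1 (hLR _ hx)
        · exact absurd (c.1 ▸ huR) (hLR _ hx)
        · exact absurd (c.1 ▸ hvR) (hLR _ hx)
      rcases h1 with h1 | h1 | h1
      · have hr := toR p hp h1
        rcases h2 with h2 | h2 | h2
        · exact hne (uF r p q (sF _ _ h1) (sF _ _ h2) (fun e => hLR _ hp (e ▸ hr)))
        · exact hLR _ (mG _ _ h2).2 hr
        · exact hLR _ hq (mH _ _ h2).1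
      · rcases h2 with h2 | h2 | h2
        · exact hLR _ (mG _ _ h1).2 (toR q hq h2)
        · exact G6 r h1 h2
        · exact hLR _ hq (mH _ _ h2).1
      · exact hLR _ hp (mH _ _ h1).1

lemma exists_f (S : Finset Pt) : ∃ f : Pt →ₗ[ℝ] ℝ, Set.InjOn f S := by
  obtain ⟨t, ht⟩ := Infinite.exists_notMem_finset
    ((S ×ˢ S).image fun x : Pt × Pt => -(x.1.1 - x.2.1) / (x.1.2 - x.2.2))
  refine ⟨LinearMap.fst ℝ ℝ ℝ + t • LinearMap.snd ℝ ℝ ℝ, ?_⟩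
  intro a ha b hb h
  simp at h
  by_cases h2 : a.2 = b.2
  · rw [h2] at h
    exact Prod.ext (by linarith) h2
  · exfalso
    apply ht
    rw [Finset.mem_image]
    refine ⟨(a, b), Finset.mem_product.2 ⟨ha, hb⟩, ?_⟩
    have : a.2 - b.2 ≠ 0 := sub_ne_zero.2 h2
    rw [div_eq_iff this]
    linarith

/-- Let `S` be a set of `2n` points in general position, where
`n = 2^k + h` with `0 ≤ h < 2^k`. Then there exist (at least) `k` pairwise edge-disjoint
non-crossing perfect matchings on `S` whose union is a triangle-free geometric graph. -/
theorem stmt13 (n k h : ℕ) (hn : n = 2 ^ k + h) (hh : h < 2 ^ k)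
    (S : Finset Pt) (hcard : S.card = 2 * n) (hgp : GenPos (S : Set Pt)) :
    ∃ F : Fin k → Set (Set Pt),
      (∀ i, IsPerfectMatching (S : Set Pt) (F i)) ∧
      (∀ i, NonCrossing (F i)) ∧
      (∀ i j, i ≠ j → Disjoint (F i) (F j)) ∧
      TriangleFree (⋃ i, F i) := by
  obtain ⟨f, hf⟩ := exists_f S
  have h1 : 1 ≤ 2 ^ k := Nat.one_le_two_pow
  obtain ⟨p, q, hpq⟩ := low_exists f S hf (by omega)
  obtain ⟨F, a, b, c, d, -⟩ := main k f S hf hgp n hcard (by omega) p q hpq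
  exact ⟨F, a, b, c, d⟩
end
end

section
/- Let S be a set of 2n points in general position in the plane with n ≥ 4. If F_1, …, F_m are pairwise edge-disjoint non-crossing perfect matchings on S such that their union is a triangle-free plane geometric graph (i.e., the union itself is non-crossing and triangle-free), then m ≤ 3. -/
noncomputable section

open Classical

def sl {V : Type*} (X Y : V → ℝ) (a b : V) : ℝ := (Y b - Y a) / (X b - X a)

def hgt {V : Type*} (X Y : V → ℝ) (a b : V) (x : ℝ) : ℝ := Y a + sl X Y a b * (x - X a)

structure Good {V : Type*} (Adj : V → V → Prop) (X Y : V → ℝ) : Prop where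
  symm : ∀ a b, Adj a b → Adj b a
  xinj : ∀ a b, X a = X b → a = b
  gp : ∀ a b c, Adj a b → X a < X c → X c < X b → hgt X Y a b (X c) ≠ Y c
  nc : ∀ a b c d x, Adj a b → Adj c d → X a < x → x < X b → X c < x → x < X d →
    hgt X Y a b x = hgt X Y c d x → a = c ∧ b = d
  tf : ∀ a b c, Adj a b → Adj b c → ¬ Adj a c

structure Op {V : Type*} (Adj : V → V → Prop) (X Y : V → ℝ) (v b1 b2 w : V) : Prop where
  a1 : Adj v b1
  a2 : Adj v b2
  x1 : X v < X b1
  x2 : X v < X b2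
  s : sl X Y v b1 < sl X Y v b2
  cons : ∀ c, Adj v c → X v < X c → sl X Y v b1 < sl X Y v c → ¬ sl X Y v c < sl X Y v b2
  xw : X v < X w
  w1 : X w ≤ X b1
  w2 : X w ≤ X b2
  h1 : hgt X Y v b1 (X w) ≤ Y w
  h2 : Y w ≤ hgt X Y v b2 (X w)
  mn : ∀ u, X v < X u → X u < X w → hgt X Y v b1 (X u) ≤ Y u → ¬ Y u ≤ hgt X Y v b2 (X u)

section core
variable {V : Type*} {Adj : V → V → Prop} {X Y : V → ℝ}

lemma hgt_left (a b : V) : hgt X Y a b (X a) = Y a := by simp [hgt]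

lemma hgt_right (a b : V) (h : X a < X b) : hgt X Y a b (X b) = Y b := by
  have : X b - X a ≠ 0 := by linarith
  simp only [hgt, sl]; field_simp; ring

lemma hgt_comm (a b : V) (h : X a < X b) (x : ℝ) : hgt X Y a b x = hgt X Y b a x := by
  have h1 : X b - X a ≠ 0 := by linarith
  have h2 : X a - X b ≠ 0 := by linarith
  have : sl X Y b a = sl X Y a b := by
    simp only [sl]; rw [div_eq_div_iff h2 h1]; ring
  have h3 := hgt_right (Y := Y) a b h
  simp only [hgt, this] at h3 ⊢
  linarith [h3]

lemma sl_negX (a b : V) : sl (fun v => -X v) Y a b = - sl X Y a b := by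
  simp only [sl]; rw [← div_neg]; congr 1; ring

lemma sl_negY (a b : V) : sl X (fun v => -Y v) a b = - sl X Y a b := by
  simp only [sl]; rw [← neg_div]; congr 1; ring

lemma hgt_negX (a b : V) (x : ℝ) : hgt (fun v => -X v) Y a b x = hgt X Y a b (-x) := by
  simp only [hgt, sl_negX]; ring

lemma hgt_negY (a b : V) (x : ℝ) : hgt X (fun v => -Y v) a b x = - hgt X Y a b x := by
  simp only [hgt, sl_negY]; ring

lemma Good.negX (G : Good Adj X Y) : Good Adj (fun v => -X v) Y where
  symm := G.symm
  xinj a b h := G.xinj a b (by simpa using h)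
  gp a b c h h1 h2 := by
    rw [hgt_negX, neg_neg]
    rw [← hgt_comm b a (by linarith)]
    exact G.gp b a c (G.symm _ _ h) (by simpa using h2) (by simpa using h1)
  nc a b c d x h h' h1 h2 h3 h4 e := by
    rw [hgt_negX, hgt_negX, ← hgt_comm b a (by linarith),
      ← hgt_comm d c (by linarith)] at e
    exact (G.nc b a d c (-x) (G.symm _ _ h) (G.symm _ _ h') (by linarith) (by linarith)
      (by linarith) (by linarith) e).symm
  tf := G.tf

lemma Good.negY (G : Good Adj X Y) : Good Adj X (fun v => -Y v) where
  symm := G.symm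
  xinj := G.xinj
  gp a b c h h1 h2 := by
    rw [hgt_negY]; simpa using G.gp a b c h h1 h2
  nc a b c d x h h' h1 h2 h3 h4 e := by
    rw [hgt_negY, hgt_negY, neg_inj] at e
    exact G.nc a b c d x h h' h1 h2 h3 h4 e
  tf := G.tf

lemma Op.negY {v b1 b2 w : V} (O : Op Adj X Y v b1 b2 w) : Op Adj X (fun v => -Y v) v b2 b1 w where
  a1 := O.a2
  a2 := O.a1
  x1 := O.x2
  x2 := O.x1
  s := by rw [sl_negY, sl_negY]; linarith [O.s]
  cons c h h1 h2 h3 := by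
    rw [sl_negY, sl_negY] at h2 h3
    exact O.cons c h h1 (by linarith) (by linarith)
  xw := O.xw
  w1 := O.w2
  w2 := O.w1
  h1 := by rw [hgt_negY]; linarith [O.h2]
  h2 := by rw [hgt_negY]; linarith [O.h1]
  mn u h1 h2 h3 h4 := by
    rw [hgt_negY] at h3 h4
    exact O.mn u h1 h2 (by linarith) (by linarith)

lemma hgt_cont (a b : V) : Continuous (hgt X Y a b) := by
  unfold hgt; fun_prop

lemma Good.noX (G : Good Adj X Y) {a b c d : V} {z x0 : ℝ} (h : Adj a b) (h' : Adj c d)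
    (hz : z < x0) (ha : X a ≤ z) (hc : X c ≤ z) (hb : x0 ≤ X b) (hd : x0 ≤ X d)
    (h1 : hgt X Y a b z < hgt X Y c d z) (h2 : hgt X Y c d x0 < hgt X Y a b x0) : False := by
  have := intermediate_value_Ioo (f := fun x => hgt X Y a b x - hgt X Y c d x) hz.le
    ((hgt_cont a b).sub (hgt_cont c d)).continuousOn
  obtain ⟨x, ⟨hx1, hx2⟩, hx⟩ := this (show (0:ℝ) ∈ _ from ⟨by linarith, by linarith⟩)
  obtain ⟨rfl, rfl⟩ := G.nc a b c d x h h' (by linarith) (by linarith) (by linarith)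
    (by linarith) (by simp only at hx; linarith)
  linarith

lemma Good.L1 (G : Good Adj X Y) {v b1 b2 w : V} (O : Op Adj X Y v b1 b2 w) {c d : V} {x0 : ℝ}
    (h : Adj c d) (hv : X v < x0) (hw : x0 ≤ X w) (hc : X c < x0) (hd : x0 ≤ X d)
    (h1 : hgt X Y v b1 x0 < hgt X Y c d x0) (h2 : hgt X Y c d x0 < hgt X Y v b2 x0) : False := by
  have := O.w1
  have := O.w2
  rcases lt_trichotomy (X v) (X c) with hvc | hvc | hvc
  · by_cases k1 : hgt X Y v b1 (X c) ≤ Y c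
    · have k2 := O.mn c hvc (by linarith) k1
      push Not at k2
      exact G.noX O.a2 h hc hvc.le le_rfl (by linarith) hd (by rwa [hgt_left]) h2
    · push Not at k1
      exact G.noX h O.a1 hc le_rfl hvc.le hd (by linarith) (by rwa [hgt_left]) h1
  · obtain rfl := G.xinj _ _ hvc
    have hp : 0 < x0 - X v := by linarith
    simp only [hgt, add_lt_add_iff_left] at h1 h2
    exact O.cons d h (by linarith) (lt_of_mul_lt_mul_right h1 hp.le)
      (lt_of_mul_lt_mul_right h2 hp.le)
  · rcases lt_or_gt_of_ne (G.gp c d v h hvc (by linarith)) with k | k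
    · exact G.noX h O.a1 hv hvc.le le_rfl hd (by linarith) (by rwa [hgt_left]) h1
    · exact G.noX O.a2 h hv le_rfl hvc.le (by linarith) hd (by rwa [hgt_left]) h2

lemma Good.sl_inj (G : Good Adj X Y) {v b c : V} (hb : Adj v b) (hc : Adj v c)
    (xb : X v < X b) (xc : X v < X c) (h : sl X Y v b = sl X Y v c) : b = c := by
  have e : ∀ x, hgt X Y v b x = hgt X Y v c x := fun x => by simp [hgt, h]
  rcases lt_trichotomy (X b) (X c) with k | k | k
  · exact absurd (by rw [← e, hgt_right _ _ xb]) (G.gp v c b hc xb k)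
  · exact G.xinj _ _ k
  · exact absurd (by rw [e, hgt_right _ _ xc]) (G.gp v b c hb xc k)

lemma Good.sb (G : Good Adj X Y) {v b1 b2 : V} (O : Op Adj X Y v b1 b2 b1) :
    X b1 < X b2 ∧ Y b1 < hgt X Y v b2 (X b1) := by
  have : X b1 < X b2 := by
    refine lt_of_le_of_ne O.w2 fun h => ?_
    obtain rfl := G.xinj _ _ h
    exact lt_irrefl _ O.s
  exact ⟨this, lt_of_le_of_ne O.h2 (G.gp v b2 b1 O.a2 O.x1 this).symm⟩

/-- the first edge is the topmost one entering its right end -/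
lemma Good.L2 (G : Good Adj X Y) {v b1 b2 : V} (O : Op Adj X Y v b1 b2 b1) {u : V}
    (h : Adj u b1) (hu : X u < X b1) (x : ℝ) (hx : x < X b1) :
    hgt X Y u b1 x ≤ hgt X Y v b1 x := by
  by_contra hlt
  push Not at hlt
  obtain ⟨_, k⟩ := G.sb O
  have e1 := hgt_right (Y := Y) u b1 hu
  have e2 := hgt_right (Y := Y) v b1 O.x1
  have hev : ∀ᶠ t in nhdsWithin (X b1) (Set.Iio (X b1)),
      hgt X Y u b1 t < hgt X Y v b2 t ∧ X v < t ∧ X u < t ∧ t < X b1 := by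
    have c1 : ∀ᶠ t in nhds (X b1), hgt X Y u b1 t < hgt X Y v b2 t :=
      (hgt_cont u b1).continuousAt.eventually_lt (hgt_cont v b2).continuousAt (by rwa [e1])
    filter_upwards [nhdsWithin_le_nhds c1, nhdsWithin_le_nhds (lt_mem_nhds O.x1),
      nhdsWithin_le_nhds (lt_mem_nhds hu), self_mem_nhdsWithin] with t a b c d
    exact ⟨a, b, c, d⟩
  obtain ⟨t, t1, t2, t3, t4⟩ := hev.exists
  refine G.L1 O h t2 t4.le t3 t4.le ?_ t1
  rw [hgt_comm v b1 O.x1, hgt_comm u b1 hu] at hlt ⊢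
  simp only [hgt, add_lt_add_iff_left] at hlt ⊢
  have hs : sl X Y b1 u < sl X Y b1 v := by
    by_contra hs
    push Not at hs
    nlinarith
  nlinarith

lemma Good.inj1 (G : Good Adj X Y) {v v' b1 b2 b2' : V} (O : Op Adj X Y v b1 b2 b1)
    (O' : Op Adj X Y v' b1 b2' b1) : v = v' := by
  obtain ⟨x, hx1, hx2⟩ := exists_between (max_lt O.x1 O'.x1)
  have hx := max_lt_iff.1 hx1
  exact (G.nc v b1 v' b1 x O.a1 O'.a1 hx.1 hx2 hx.2 hx2
    (le_antisymm (G.L2 O' O.a1 O.x1 x hx2) (G.L2 O O'.a1 O'.x1 x hx2))).1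

lemma Good.inj2 (G : Good Adj X Y) {v v' b1 b1' b2 : V} (O : Op Adj X Y v b1 b2 b2)
    (O' : Op Adj X Y v' b1' b2 b2) : v = v' ∧ b1 = b1' := by
  obtain rfl := G.negY.inj1 O.negY O'.negY
  refine ⟨rfl, G.sl_inj O.a1 O'.a1 O.x1 O'.x1 ?_⟩
  by_contra h
  rcases lt_or_gt_of_ne h with h | h
  · exact O.cons _ O'.a1 O'.x1 h O'.s
  · exact O'.cons _ O.a1 O.x1 h O.s

lemma Good.si (G : Good Adj X Y) {v b1 b2 w : V} (O : Op Adj X Y v b1 b2 w) (h1 : X w < X b1)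
    (h2 : X w < X b2) : hgt X Y v b1 (X w) < Y w ∧ Y w < hgt X Y v b2 (X w) :=
  ⟨lt_of_le_of_ne O.h1 (G.gp _ _ _ O.a1 O.xw h1),
    lt_of_le_of_ne O.h2 (G.gp _ _ _ O.a2 O.xw h2).symm⟩

lemma Good.L3 (G : Good Adj X Y) {v b1 b2 w : V} (O : Op Adj X Y v b1 b2 w) (h1 : X w < X b1)
    (h2 : X w < X b2) (u : V) (h : Adj u w) : ¬ X u < X w := by
  intro hu
  obtain ⟨k1, k2⟩ := G.si O h1 h2
  exact G.L1 O h O.xw le_rfl hu le_rfl (by rwa [hgt_right _ _ hu]) (by rwa [hgt_right _ _ hu])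

lemma Good.inj3 (G : Good Adj X Y) {v b1 b2 w v' b1' b2' : V} (O : Op Adj X Y v b1 b2 w)
    (O' : Op Adj X Y v' b1' b2' w) (h1 : X w < X b1)
    (h2 : X w < X b2) (h1' : X w < X b1') (h2' : X w < X b2') : v = v' ∧ b1 = b1' := by
  obtain ⟨k1, k2⟩ := G.si O h1 h2
  obtain ⟨k1', k2'⟩ := G.si O' h1' h2'
  refine G.nc v b1 v' b1' (X w) O.a1 O'.a1 O.xw h1 O'.xw h1' (le_antisymm ?_ ?_)
  · by_contra h
    push Not at h
    exact G.L1 O' O.a1 O'.xw le_rfl O.xw h1.le h (by linarith)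
  · by_contra h
    push Not at h
    exact G.L1 O O'.a1 O.xw le_rfl O'.xw h1'.le h (by linarith)

lemma Good.cross (G : Good Adj X Y) {v b2 w v' b2' : V} (O : Op Adj X Y v w b2 w)
    (O' : Op Adj (fun v => -X v) Y v' w b2' w) : False := by
  obtain ⟨k1, k2⟩ := G.sb O
  obtain ⟨k1', k2'⟩ := G.negX.sb O'
  have y1 := O'.x1
  have y2 := O'.x2
  rw [hgt_negX, neg_neg, ← hgt_comm b2' v' (by linarith)] at k2'
  have e1 := hgt_right (Y := Y) v w O.x1
  have e2 := hgt_right (Y := Y) w v' (by linarith)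
  have key : hgt X Y v b2 (X w) = hgt X Y b2' v' (X w) := by
    refine le_antisymm ?_ ?_
    · by_contra h
      push Not at h
      exact G.L1 O (G.symm _ _ O'.a2) O.xw le_rfl (by linarith) (by linarith)
        (by rwa [e1]) h
    · by_contra h
      push Not at h
      refine G.negX.L1 O' (G.symm _ _ O.a2) O'.xw le_rfl (by linarith)
        (by linarith [O.x1]) ?_ ?_
      · rw [hgt_negX, hgt_negX, neg_neg, ← hgt_comm w v' (by linarith), hgt_left,
          ← hgt_comm v b2 O.x2]
        exact k2
      · rw [hgt_negX, hgt_negX, neg_neg, ← hgt_comm b2' v' (by linarith),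
          ← hgt_comm v b2 O.x2]
        exact h
  obtain ⟨rfl, rfl⟩ := G.nc v b2 b2' v' (X w) O.a2 (G.symm _ _ O'.a2) O.x1 k1 (by linarith)
    (by linarith) key
  exact G.tf v w b2 O.a1 (G.symm _ _ O'.a1) O.a2

lemma Good.cross' (G : Good Adj X Y) {v b1 w v' b1' : V} (O : Op Adj X Y v b1 w w)
    (O' : Op Adj (fun v => -X v) Y v' b1' w w) : False :=
  G.negY.cross O.negY O'.negY

lemma exOp [Finite V] {v b c : V} (hb : Adj v b) (hc : Adj v c)
    (xb : X v < X b) (xc : X v < X c) (h : sl X Y v b < sl X Y v c) :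
    ∃ b2 w, Op Adj X Y v b b2 w := by
  obtain ⟨b2, ⟨p1, p2, p3⟩, p4⟩ := Set.exists_min_image
    {d | Adj v d ∧ X v < X d ∧ sl X Y v b < sl X Y v d} (sl X Y v) (Set.toFinite _) ⟨c, hc, xc, h⟩
  have hmono : ∀ x, X v < x → hgt X Y v b x ≤ hgt X Y v b2 x := by
    intro x hx
    simp only [hgt]
    nlinarith
  obtain ⟨w, ⟨q1, q2, q3, q4, q5⟩, q6⟩ := Set.exists_min_image
    {w | X v < X w ∧ X w ≤ X b ∧ X w ≤ X b2 ∧ hgt X Y v b (X w) ≤ Y w ∧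
      Y w ≤ hgt X Y v b2 (X w)} X (Set.toFinite _) (by
      rcases le_total (X b) (X b2) with k | k
      · exact ⟨b, xb, le_rfl, k, (hgt_right _ _ xb).le, by
          rw [← hgt_right (Y := Y) _ _ xb]; exact hmono _ xb⟩
      · exact ⟨b2, p2, k, le_rfl, by
          rw [← hgt_right (Y := Y) _ _ p2]; exact hmono _ p2, (hgt_right _ _ p2).ge⟩)
  refine ⟨b2, w, hb, p1, xb, p2, p3, ?_, q1, q2, q3, q4, q5, ?_⟩
  · intro d d1 d2 d3 d4
    exact absurd (p4 d ⟨d1, d2, d3⟩) (not_le.2 d4)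
  · intro u u1 u2 u3 u4
    exact absurd (q6 u ⟨u1, by linarith, by linarith, u3, u4⟩) (not_le.2 u2)

end core

section count
variable {V : Type*} {Adj : V → V → Prop} {X Y : V → ℝ}

/-- darts that are not topmost at their left end -/
def OpD (Adj : V → V → Prop) (X Y : V → ℝ) : Type _ :=
  {p : V × V // Adj p.1 p.2 ∧ X p.1 < X p.2 ∧
    ∃ c, Adj p.1 c ∧ X p.1 < X c ∧ sl X Y p.1 p.2 < sl X Y p.1 c}

def Drt (Adj : V → V → Prop) (X : V → ℝ) : Type _ :=
  {p : V × V // Adj p.1 p.2 ∧ X p.1 < X p.2}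

/-- vertices without edge to the left -/
def L0 (Adj : V → V → Prop) (X : V → ℝ) : Type _ :=
  {w : V // ∀ u, Adj u w → ¬ X u < X w}

def Tg (Adj : V → V → Prop) (X Y : V → ℝ) (v b1 : V) (t : (V × Bool) ⊕ L0 Adj X) : Prop :=
  ∃ b2 w, Op Adj X Y v b1 b2 w ∧
    ((w = b1 ∧ t = Sum.inl (w, true)) ∨ (w = b2 ∧ t = Sum.inl (w, false)) ∨
      ∃ l : L0 Adj X, l.1 = w ∧ t = Sum.inr l ∧ X w < X b1 ∧ X w < X b2)

lemma Good.exTg [Finite V] (G : Good Adj X Y) (p : OpD Adj X Y) :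
    ∃ t, Tg Adj X Y p.1.1 p.1.2 t := by
  obtain ⟨⟨v, b1⟩, h1, h2, c, h3, h4, h5⟩ := p
  obtain ⟨b2, w, O⟩ := exOp h1 h3 h2 h4 h5
  by_cases e1 : w = b1
  · exact ⟨_, b2, w, O, Or.inl ⟨e1, rfl⟩⟩
  by_cases e2 : w = b2
  · exact ⟨_, b2, w, O, Or.inr (Or.inl ⟨e2, rfl⟩)⟩
  have k1 : X w < X b1 := lt_of_le_of_ne O.w1 fun h => e1 (G.xinj _ _ h)
  have k2 : X w < X b2 := lt_of_le_of_ne O.w2 fun h => e2 (G.xinj _ _ h)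
  exact ⟨_, b2, w, O, Or.inr (Or.inr ⟨⟨w, G.L3 O k1 k2⟩, rfl, rfl, k1, k2⟩)⟩

lemma Good.TgInj (G : Good Adj X Y) {v b v' b' : V} {t : (V × Bool) ⊕ L0 Adj X}
    (h : Tg Adj X Y v b t) (h' : Tg Adj X Y v' b' t) : v = v' ∧ b = b' := by
  obtain ⟨b2, w, O, h⟩ := h
  obtain ⟨b2', w', O', h'⟩ := h'
  rcases h with ⟨rfl, rfl⟩ | ⟨rfl, rfl⟩ | ⟨l, rfl, rfl, h1, h2⟩
  · rcases h' with ⟨rfl, h'⟩ | ⟨rfl, h'⟩ | ⟨l, rfl, h', h1, h2⟩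
    · simp only [Sum.inl.injEq, Prod.mk.injEq, and_true] at h'
      subst h'
      exact ⟨G.inj1 O O', rfl⟩
    · simp at h'
    · simp at h'
  · rcases h' with ⟨rfl, h'⟩ | ⟨rfl, h'⟩ | ⟨l, rfl, h', h1, h2⟩
    · simp at h'
    · simp only [Sum.inl.injEq, Prod.mk.injEq, and_true] at h'
      subst h'
      exact G.inj2 O O'
    · simp at h'
  · rcases h' with ⟨rfl, h'⟩ | ⟨rfl, h'⟩ | ⟨l', rfl, h', h1', h2'⟩
    · simp at h'
    · simp at h'
    · simp only [Sum.inr.injEq] at h'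
      subst h'
      exact G.inj3 O O' h1 h2 h1' h2'

lemma Good.TgCross (G : Good Adj X Y) {v b v' b' : V} {s : V × Bool}
    (h : Tg Adj X Y v b (Sum.inl s)) (h' : Tg Adj (fun v => -X v) Y v' b' (Sum.inl s)) : False := by
  obtain ⟨b2, w, O, h⟩ := h
  obtain ⟨b2', w', O', h'⟩ := h'
  rcases h with ⟨rfl, h⟩ | ⟨rfl, h⟩ | ⟨l, rfl, h, _⟩
  · rcases h' with ⟨rfl, h'⟩ | ⟨rfl, h'⟩ | ⟨l, rfl, h', _⟩
    · simp only [Sum.inl.injEq] at h h'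
      have := h.symm.trans h'
      simp only [Prod.mk.injEq, and_true] at this
      subst this
      exact G.cross O O'
    · simp only [Sum.inl.injEq] at h h'
      simpa using h.symm.trans h'
    · simp at h'
  · rcases h' with ⟨rfl, h'⟩ | ⟨rfl, h'⟩ | ⟨l, rfl, h', _⟩
    · simp only [Sum.inl.injEq] at h h'
      simpa using h.symm.trans h'
    · simp only [Sum.inl.injEq] at h h'
      have := h.symm.trans h'
      simp only [Prod.mk.injEq, and_true] at this
      subst this
      exact G.cross' O O'
    · simp at h'
  · simp at h

lemma Tg_ne {v b : V} {l : L0 Adj X} (h : Tg Adj X Y v b (Sum.inr l)) : ∃ u, X u < X l.1 := by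
  obtain ⟨b2, w, O, h⟩ := h
  rcases h with ⟨rfl, h⟩ | ⟨rfl, h⟩ | ⟨l, rfl, h, _⟩
  · simp at h
  · simp at h
  · simp only [Sum.inr.injEq] at h
    subst h
    exact ⟨v, O.xw⟩

instance [Finite V] : Finite (OpD Adj X Y) := by unfold OpD; infer_instance
instance [Finite V] : Finite (Drt Adj X) := by unfold Drt; infer_instance
instance [Finite V] : Finite (L0 Adj X) := by unfold L0; infer_instance

lemma Good.cardA [Finite V] (G : Good Adj X Y) :
    Nat.card (Drt Adj X) + Nat.card (L0 Adj (fun v => -X v)) ≤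
      Nat.card (OpD Adj X Y) + Nat.card V := by
  rw [← Nat.card_sum, ← Nat.card_sum]
  let f : Drt Adj X ⊕ L0 Adj (fun v => -X v) → OpD Adj X Y ⊕ V := Sum.elim
    (fun p => if h : ∃ c, Adj p.1.1 c ∧ X p.1.1 < X c ∧ sl X Y p.1.1 p.1.2 < sl X Y p.1.1 c then
      Sum.inl ⟨p.1, p.2.1, p.2.2, h⟩ else Sum.inr p.1.1) (fun w => Sum.inr w.1)
  refine Nat.card_le_card_of_injective f ?_
  have key : ∀ (p : Drt Adj X) (w : L0 Adj (fun v => -X v)), f (Sum.inl p) ≠ f (Sum.inr w) := by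
    intro p w h
    simp only [f, Sum.elim_inl, Sum.elim_inr] at h
    split_ifs at h with h1
    simp only [Sum.inr.injEq] at h
    have := w.2 p.1.2 (by rw [← h]; exact G.symm _ _ p.2.1)
    have h3 := p.2.2
    rw [← h] at this
    linarith
  rintro (p | w) (p' | w') h
  · simp only [f, Sum.elim_inl] at h
    congr 1
    apply Subtype.ext
    split_ifs at h with h1 h2 h2
    · exact congrArg (fun q : OpD Adj X Y => q.1) (Sum.inl_injective h)
    · simp only [Sum.inr.injEq] at h
      obtain ⟨⟨v, b⟩, a1, a2⟩ := p
      obtain ⟨⟨v', b'⟩, a1', a2'⟩ := p'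
      simp only at h h1 h2 a1 a2 a1' a2'
      subst h
      have : b = b' := G.sl_inj a1 a1' a2 a2' (by
        by_contra hne
        rcases lt_or_gt_of_ne hne with k | k
        · exact h1 ⟨_, a1', a2', k⟩
        · exact h2 ⟨_, a1, a2, k⟩)
      exact congrArg (Prod.mk v) this
  · exact absurd h (key _ _)
  · exact absurd h.symm (key _ _)
  · simp only [f, Sum.elim_inr, Sum.inr.injEq] at h
    exact congrArg _ (Subtype.ext h)

lemma Good.cardB [Finite V] [Nonempty V] (G : Good Adj X Y) :
    Nat.card (OpD Adj X Y) + Nat.card (OpD Adj (fun v => -X v) Y) <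
      Nat.card V * 2 + (Nat.card (L0 Adj X) + Nat.card (L0 Adj (fun v => -X v))) := by
  have e2 : Nat.card V * 2 = Nat.card (V × Bool) := by simp [Nat.card_prod]
  rw [e2, ← Nat.card_sum, ← Nat.card_sum, ← Nat.card_sum]
  choose f hf using G.exTg
  choose g hg using G.negX.exTg
  let i : (V × Bool) ⊕ L0 Adj X → (V × Bool) ⊕ (L0 Adj X ⊕ L0 Adj (fun v => -X v)) :=
    Sum.map id Sum.inl
  let j : (V × Bool) ⊕ L0 Adj (fun v => -X v) → (V × Bool) ⊕ (L0 Adj X ⊕ L0 Adj (fun v => -X v)) :=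
    Sum.map id Sum.inr
  have hi : Function.Injective i := Function.Injective.sumMap (fun _ _ h => h) Sum.inl_injective
  have hj : Function.Injective j := Function.Injective.sumMap (fun _ _ h => h) Sum.inr_injective
  have hij : ∀ p q, i (f p) ≠ j (g q) := by
    intro p q h
    have a := hf p
    have b := hg q
    rcases hfp : f p with s | l <;> rcases hgq : g q with s' | l' <;> rw [hfp, hgq] at h <;>
      simp [i, j] at h
    subst h
    rw [hfp] at a
    rw [hgq] at b
    exact G.TgCross a b
  have hinj : Function.Injective (Sum.elim (i ∘ f) (j ∘ g)) := by
    refine Function.Injective.sumElim (hi.comp ?_) (hj.comp ?_) hij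
    · intro p q h
      have := hf q
      rw [← h] at this
      obtain ⟨h1, h2⟩ := G.TgInj (hf p) this
      exact Subtype.ext (Prod.ext h1 h2)
    · intro p q h
      have := hg q
      rw [← h] at this
      obtain ⟨h1, h2⟩ := G.negX.TgInj (hg p) this
      exact Subtype.ext (Prod.ext h1 h2)
  obtain ⟨v0, hv0⟩ := Finite.exists_min X
  let l0 : L0 Adj X := ⟨v0, fun u _ => not_lt.2 (hv0 u)⟩
  have hns : Sum.inr (Sum.inl l0) ∉ Set.range (Sum.elim (i ∘ f) (j ∘ g)) := by
    rintro ⟨p | q, h⟩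
    · have a := hf p
      simp only [Sum.elim_inl, Function.comp] at h
      rcases hfp : f p with s | l <;> rw [hfp] at h <;> simp [i] at h
      rw [hfp] at a
      obtain ⟨u, hu⟩ := Tg_ne a
      rw [h] at hu
      exact absurd (hv0 u) (not_le.2 hu)
    · simp only [Sum.elim_inr, Function.comp] at h
      rcases hfp : g q with s | l <;> rw [hfp] at h <;> simp [j] at h
  have := Fintype.ofFinite ((V × Bool) ⊕ (L0 Adj X ⊕ L0 Adj (fun v => -X v)))
  have := Fintype.ofFinite (OpD Adj X Y ⊕ OpD Adj (fun v => -X v) Y)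
  rw [Nat.card_eq_fintype_card, Nat.card_eq_fintype_card]
  exact Fintype.card_lt_of_injective_of_notMem _ hinj hns

lemma Good.main [Finite V] [Nonempty V] (G : Good Adj X Y) :
    Nat.card {p : V × V // Adj p.1 p.2} < 4 * Nat.card V := by
  have h1 := G.cardA
  have h2 := G.negX.cardA
  have h3 := G.cardB
  simp only [neg_neg] at h2
  have h4 : Nat.card {p : V × V // Adj p.1 p.2} ≤
      Nat.card (Drt Adj X) + Nat.card (Drt Adj (fun v => -X v)) := by
    rw [← Nat.card_sum]
    refine Nat.card_le_card_of_surjective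
      (Sum.elim (fun p => ⟨p.1, p.2.1⟩) (fun p => ⟨p.1, p.2.1⟩)) ?_
    rintro ⟨⟨a, b⟩, h⟩
    rcases lt_trichotomy (X a) (X b) with k | k | k
    · exact ⟨Sum.inl ⟨(a, b), h, k⟩, rfl⟩
    · obtain rfl := G.xinj _ _ k
      exact absurd h (G.tf a a a h h)
    · exact ⟨Sum.inr ⟨(a, b), h, neg_lt_neg k⟩, rfl⟩
  have h5 : Nat.card (L0 Adj fun v => X v) = Nat.card (L0 Adj X) := rfl
  omega

end count

lemma exists_eps (S : Finset Pt) :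
    ∃ ε : ℝ, ∀ p ∈ S, ∀ q ∈ S, p.1 + ε * p.2 = q.1 + ε * q.2 → p = q := by
  have hfin : (⋃ z ∈ (S ×ˢ S : Finset (Pt × Pt)),
      {ε : ℝ | z.1 ≠ z.2 ∧ z.1.1 + ε * z.1.2 = z.2.1 + ε * z.2.2}).Finite := by
    refine Set.Finite.biUnion (Finset.finite_toSet _) fun z _ => Set.Subsingleton.finite ?_
    rintro a ⟨hne, ha⟩ b ⟨-, hb⟩
    by_contra hab
    apply hne
    have h1 : (a - b) * (z.1.2 - z.2.2) = 0 := by linarith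
    have h2 : z.1.2 = z.2.2 := by
      rcases mul_eq_zero.1 h1 with h | h
      · exact absurd (sub_eq_zero.1 h) hab
      · linarith
    refine Prod.ext ?_ h2
    rw [h2] at ha
    linarith
  obtain ⟨ε, hε⟩ := hfin.exists_notMem
  refine ⟨ε, fun p hp q hq h => ?_⟩
  by_contra hne
  exact hε (Set.mem_biUnion (x := (p, q)) (Finset.mem_coe.2 (Finset.mk_mem_product hp hq)) ⟨hne, h⟩)

/-- The point of the line `ab` at sheared abscissa `x`. -/
lemma mem_seg (ε x y : ℝ) (a b : Pt) (h1 : a.1 + ε * a.2 < x) (h2 : x < b.1 + ε * b.2)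
    (h : a.2 + (b.2 - a.2) / (b.1 + ε * b.2 - (a.1 + ε * a.2)) * (x - (a.1 + ε * a.2)) = y) :
    ((x - ε * y, y) : Pt) ∈ openSegment ℝ a b := by
  have hd : 0 < b.1 + ε * b.2 - (a.1 + ε * a.2) := by linarith
  rw [openSegment_eq_image]
  refine ⟨(x - (a.1 + ε * a.2)) / (b.1 + ε * b.2 - (a.1 + ε * a.2)),
    ⟨div_pos (by linarith) hd, (div_lt_one hd).2 (by linarith)⟩, ?_⟩
  subst h
  set D := b.1 + ε * b.2 - (a.1 + ε * a.2) with hD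
  have hb : b.1 = D + (a.1 + ε * a.2) - ε * b.2 := by rw [hD]; ring
  have hne := hd.ne'
  clear_value D
  refine Prod.ext ?_ ?_
  · simp only [Prod.fst_add, Prod.smul_fst, smul_eq_mul, hb]
    field_simp
    ring
  · simp only [Prod.snd_add, Prod.smul_snd, smul_eq_mul]
    field_simp
    ring

/-- Let `S` be a set of `2n` points in general position, `n ≥ 4`. If
`F 1, …, F m` are pairwise edge-disjoint non-crossing perfect matchings on `S` whose union
is a triangle-free plane geometric graph (the union itself is non-crossing and
triangle-free), then `m ≤ 3`. -/
theorem stmt14 (n : ℕ) (hn : 4 ≤ n) (S : Finset Pt) (hcard : S.card = 2 * n)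
    (hgp : GenPos (S : Set Pt)) (m : ℕ) (F : Fin m → Set (Set Pt))
    (hpm : ∀ i, IsPerfectMatching (S : Set Pt) (F i))
    (hnc : ∀ i, NonCrossing (F i))
    (hdisj : ∀ i j, i ≠ j → Disjoint (F i) (F j))
    (hplane : NonCrossing (⋃ i, F i))
    (htf : TriangleFree (⋃ i, F i)) :
    m ≤ 3 := by
  by_contra hm
  push Not at hm
  obtain ⟨ε, hε⟩ := exists_eps S
  let X : S → ℝ := fun p => p.1.1 + ε * p.1.2
  let Y : S → ℝ := fun p => p.1.2
  let Adj : S → S → Prop := fun a b => a ≠ b ∧ ({a.1, b.1} : Set Pt) ∈ ⋃ i, F i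
  have G : Good Adj X Y := by
    refine ⟨?_, ?_, ?_, ?_, ?_⟩
    · rintro a b ⟨h1, h2⟩
      exact ⟨h1.symm, by rwa [Set.pair_comm]⟩
    · intro a b h
      exact Subtype.ext (hε a.1 a.2 b.1 b.2 h)
    · rintro a b c ⟨hab, -⟩ h1 h2 h
      have hmem := mem_seg ε (X c) (Y c) a.1 b.1 h1 h2 h
      have hc : ((X c - ε * Y c, Y c) : Pt) = c.1 := by simp [X, Y]
      rw [hc] at hmem
      have hac : a ≠ c := by rintro rfl; exact lt_irrefl _ h1
      have hcb : c ≠ b := by rintro rfl; exact lt_irrefl _ h2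
      refine hgp a.1 a.2 c.1 c.2 b.1 b.2 (fun h => hac (Subtype.ext h))
        (fun h => hab (Subtype.ext h)) (fun h => hcb (Subtype.ext h)) ?_
      exact (mem_segment_iff_wbtw.1 (openSegment_subset_segment ℝ _ _ hmem)).collinear
    · rintro a b c d x ⟨hab, h1⟩ ⟨hcd, h2⟩ k1 k2 k3 k4 h
      have m1 := mem_seg ε x (hgt X Y a b x) a.1 b.1 k1 k2 rfl
      have m2 := mem_seg ε x (hgt X Y a b x) c.1 d.1 k3 k4 h.symm
      have hne : ∀ a b : S, a ≠ b → a.1 ≠ b.1 := fun a b h k => h (Subtype.ext k)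
      have e : ({a.1, b.1} : Set Pt) = {c.1, d.1} := by
        by_contra hc
        have := hplane _ h1 _ h2 hc
        have hm : ((x - ε * hgt X Y a b x, hgt X Y a b x) : Pt) ∈
            openSeg {a.1, b.1} ∩ openSeg {c.1, d.1} :=
          ⟨⟨a.1, by simp, b.1, by simp, hne _ _ hab, m1⟩,
            ⟨c.1, by simp, d.1, by simp, hne _ _ hcd, m2⟩⟩
        rw [this] at hm
        exact hm
      rcases Set.pair_eq_pair_iff.1 e with ⟨e1, e2⟩ | ⟨e1, e2⟩
      · exact ⟨Subtype.ext e1, Subtype.ext e2⟩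
      · have e1 : a = d := Subtype.ext e1
        subst e1
        linarith
    · rintro a b c ⟨hab, h1⟩ ⟨hbc, h2⟩ ⟨hac, h3⟩
      exact htf ⟨a.1, b.1, c.1, fun h => hab (Subtype.ext h), fun h => hac (Subtype.ext h),
        fun h => hbc (Subtype.ext h), h1, h2, h3⟩
  have hS : S.Nonempty := Finset.card_pos.1 (by omega)
  haveI : Nonempty S := hS.to_subtype
  have hlt := G.main
  have hpart : ∀ (i : Fin m) (p : S), ∃ q : S, p ≠ q ∧ ({p.1, q.1} : Set Pt) ∈ F i := by
    intro i p
    obtain ⟨e, ⟨he, hpe⟩, -⟩ := (hpm i).2 p.1 p.2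
    obtain ⟨a, b, hab, ha, hb, rfl⟩ := (hpm i).1 e he
    rcases hpe with h | h
    · exact ⟨⟨b, hb⟩, fun k => hab (by rw [← h, k]), by rw [h]; exact he⟩
    · refine ⟨⟨a, ha⟩, fun k => hab (by rw [← (show p.1 = b from h), k]), ?_⟩
      rw [show p.1 = b from h, Set.pair_comm]; exact he
  choose q hq1 hq2 using hpart
  have hge : Nat.card (Fin 4 × S) ≤ Nat.card {p : S × S // Adj p.1 p.2} := by
    let c : Fin 4 → Fin m := Fin.castLE hm
    refine Nat.card_le_card_of_injective
      (fun z => ⟨(z.2, q (c z.1) z.2), hq1 _ _, Set.mem_iUnion.2 ⟨_, hq2 _ _⟩⟩) ?_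
    rintro ⟨i, p⟩ ⟨j, p'⟩ h
    simp only [Subtype.mk.injEq, Prod.mk.injEq] at h
    obtain ⟨rfl, h⟩ := h
    have hc : c i = c j := by
      by_contra hne
      refine Set.disjoint_left.1 (hdisj _ _ hne) (hq2 (c i) p) ?_
      rw [h]
      exact hq2 (c j) p
    have : i = j := Fin.castLE_injective hm hc
    rw [this]
  rw [Nat.card_prod, Nat.card_fin] at hge
  omega
end
end

section
/- Let S be a set of 2n points in convex position in the plane with n ≥ 4. If F_1, …, F_m are pairwise edge-disjoint non-crossing perfect matchings on S such that their union is a triangle-free plane geometric graph (i.e., the union itself is non-crossing and triangle-free), then m ≤ 2. -/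
noncomputable section

open Classical

/-- A set of points is in convex position if every point of it is a vertex (extreme point)
of its convex hull. -/
def ConvexPos (S : Set Pt) : Prop := ∀ p ∈ S, p ∉ convexHull ℝ (S \ {p})

theorem comb_aux {V : Type} [Fintype V] [Nonempty V] (R : V → V → V → Prop) (E : V → V → Prop)
    (cyc : ∀ a b c, R a b c → R b c a)
    (asym : ∀ a b c, R a b c → ¬ R b a c)
    (tot : ∀ a b c, a ≠ b → a ≠ c → b ≠ c → R a b c ∨ R b a c)
    (tr : ∀ d a b c, R d a b → R d b c → R d a c)
    (hsym : ∀ a b, E a b → E b a)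
    (hE : ∀ a b, E a b → a ≠ b)
    (hcr : ∀ a b c d, E a b → E c d → R a b c → R b a d → False)
    (hdeg : ∀ p, ∃ x y z, x ≠ y ∧ x ≠ z ∧ y ≠ z ∧ E p x ∧ E p y ∧ E p z) : False := by
  have irr : ∀ a b, ¬ R a b b := fun a b h => by
    have h1 := cyc _ _ _ h
    exact asym _ _ _ h1 h1
  have irr2 : ∀ a b, ¬ R a b a := fun a b h => irr b a (cyc _ _ _ h)
  let L : V × V → Finset V := fun q => Finset.univ.filter (fun p => R q.1 q.2 p)
  let P : Finset (V × V) := Finset.univ.filter (fun q => (E q.1 q.2 ∨ E q.2 q.1) ∧ (L q).Nonempty)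
  have hP : P.Nonempty := by
    obtain ⟨p⟩ := ‹Nonempty V›
    obtain ⟨x, y, z, hxy, -, -, hx, hy, -⟩ := hdeg p
    rcases tot p x y (hE _ _ hx) (hE _ _ hy) hxy with h | h
    · exact ⟨(p, x), by simp only [P, L, Finset.mem_filter]; exact ⟨Finset.mem_univ _, Or.inl hx, y, by simpa using h⟩⟩
    · exact ⟨(p, y), by
        simp only [P, L, Finset.mem_filter]
        exact ⟨Finset.mem_univ _, Or.inl hy, x, by simpa using cyc _ _ _ (h)⟩⟩
  obtain ⟨⟨a, b⟩, hab, hmin⟩ := Finset.exists_min_image P (fun q => (L q).card) hP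
  simp only [P, L, Finset.mem_filter, Finset.mem_univ, true_and] at hab
  obtain ⟨hEab, c, hc⟩ := hab
  simp only [Finset.mem_filter, Finset.mem_univ, true_and] at hc
  have key : ∀ u v, (E u v ∨ E v u) → (∀ p, R u v p → R a b p) → ¬ R u v c → ∀ p, ¬ R u v p := by
    intro u v huv hsub hcn p hp
    have h1 : (u, v) ∈ P := by
      simp only [P, L, Finset.mem_filter, Finset.mem_univ, true_and]
      exact ⟨huv, p, by simpa using hp⟩
    have h2 := hmin _ h1
    have h3 : L (u, v) ⊂ L (a, b) := by
      rw [Finset.ssubset_iff_of_subset]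
      · exact ⟨c, by simpa [L] using hc, by simpa [L] using hcn⟩
      · intro q hq
        simp only [L, Finset.mem_filter, Finset.mem_univ, true_and] at hq ⊢
        exact hsub q hq
    exact absurd (Finset.card_lt_card h3) (by simpa using h2)
  have hca : c ≠ a := by rintro rfl; exact irr2 _ _ hc
  have hcb : c ≠ b := by rintro rfl; exact irr _ _ hc
  have hne : a ≠ b := by rcases hEab with h | h; exacts [hE _ _ h, (hE _ _ h).symm]
  have side : ∀ x, E c x → (∀ p, ¬ R c x p) ∨ (∀ p, ¬ R x c p) := by
    intro x hx
    have hcx := hE _ _ hx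
    by_cases hxa : x = a
    · subst hxa
      refine Or.inr (key _ _ (Or.inr hx) (fun p hp => tr _ _ _ _ hc hp) (irr _ _))
    by_cases hxb : x = b
    · subst hxb
      refine Or.inl (key _ _ (Or.inl hx) (fun p hp => ?_) (irr2 _ _))
      exact cyc _ _ _ (cyc _ _ _ (tr _ _ _ _ (cyc _ _ _ hp) (cyc _ _ _ hc)))
    have hxL : R a b x := by
      rcases tot a b x hne (Ne.symm hxa) (Ne.symm hxb) with h | h
      · exact h
      · rcases hEab with h' | h'
        · exact (hcr _ _ _ _ h' hx hc h).elim
        · exact (hcr _ _ _ _ (hsym _ _ h') hx hc h).elim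
    rcases tot a c x (Ne.symm hca) (Ne.symm hxa) hcx with h | h
    · refine Or.inr (key _ _ (Or.inr hx) (fun p hp => ?_) (irr _ _))
      have h1 : R c p x := cyc _ _ _ hp
      have h2 : R c x a := cyc _ _ _ h
      have h3 : R c p a := tr _ _ _ _ h1 h2
      exact tr _ _ _ _ hc (cyc _ _ _ (cyc _ _ _ h3))
    · refine Or.inl (key _ _ (Or.inl hx) (fun p hp => ?_) (irr2 _ _))
      have h1 : R x p c := cyc _ _ _ hp
      have h2 : R x c a := cyc _ _ _ (cyc _ _ _ h)
      have h3 : R x p a := tr _ _ _ _ h1 h2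
      exact tr _ _ _ _ hxL (cyc _ _ _ (cyc _ _ _ h3))
  obtain ⟨x, y, z, hxy, hxz, hyz, hx, hy, hz⟩ := hdeg c
  have pair : ∀ x y, E c x → E c y → x ≠ y →
      ¬ ((∀ p, ¬ R c x p) ∧ (∀ p, ¬ R c y p)) ∧ ¬ ((∀ p, ¬ R x c p) ∧ (∀ p, ¬ R y c p)) := by
    intro x y hx hy hxy
    have h := tot c x y (hE _ _ hx) (hE _ _ hy) hxy
    constructor
    · rintro ⟨h1, h2⟩
      rcases h with h | h
      · exact h1 _ h
      · exact h2 x (cyc _ _ _ h)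
    · rintro ⟨h1, h2⟩
      rcases h with h | h
      · exact h2 x (cyc _ _ _ (cyc _ _ _ h))
      · exact h1 _ h
  have p1 := pair x y hx hy hxy
  have p2 := pair x z hx hz hxz
  have p3 := pair y z hy hz hyz
  have s1 := side x hx
  have s2 := side y hy
  have s3 := side z hz
  rcases s1 with s1 | s1 <;> rcases s2 with s2 | s2
  · exact p1.1 ⟨s1, s2⟩
  · rcases s3 with s3 | s3
    · exact p2.1 ⟨s1, s3⟩
    · exact p3.2 ⟨s2, s3⟩
  · rcases s3 with s3 | s3
    · exact p3.1 ⟨s2, s3⟩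
    · exact p2.2 ⟨s1, s3⟩
  · exact p1.2 ⟨s1, s2⟩

theorem det2_ne {S : Set Pt} (h : ConvexPos S) {a b c : Pt} (ha : a ∈ S) (hb : b ∈ S) (hc : c ∈ S)
    (hab : a ≠ b) (hac : a ≠ c) (hbc : b ≠ c) : det2 a b c ≠ 0 := by
  intro h0
  have hbet : ∀ x y z : Pt, x ∈ S → y ∈ S → z ∈ S → y ≠ x → y ≠ z → ¬ Wbtw ℝ x y z := by
    intro x y z hx hy hz hyx hyz hw
    refine h y hy ?_
    have : y ∈ segment ℝ x z := mem_segment_iff_wbtw.2 hw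
    exact (convex_convexHull ℝ _).segment_subset
      (subset_convexHull ℝ (S \ {y}) ⟨hx, fun h => hyx (Set.mem_singleton_iff.1 h).symm⟩)
      (subset_convexHull ℝ (S \ {y}) ⟨hz, fun h => hyz (Set.mem_singleton_iff.1 h).symm⟩) this
  have hcol : Collinear ℝ ({a, b, c} : Set Pt) := by
    rw [collinear_iff_of_mem (p₀ := a) (by simp)]
    refine ⟨b - a, ?_⟩
    have hpos : (b.1 - a.1) ^ 2 + (b.2 - a.2) ^ 2 ≠ 0 := by
      intro hh
      apply hab
      have h1 : b.1 - a.1 = 0 := by nlinarith [sq_nonneg (b.1 - a.1), sq_nonneg (b.2 - a.2)]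
      have h2 : b.2 - a.2 = 0 := by nlinarith [sq_nonneg (b.1 - a.1), sq_nonneg (b.2 - a.2)]
      ext <;> linarith
    intro p hp
    rcases hp with rfl | rfl | hp
    · exact ⟨0, by simp⟩
    · exact ⟨1, by simp⟩
    · rw [Set.mem_singleton_iff] at hp
      subst hp
      refine ⟨((p.1 - a.1) * (b.1 - a.1) + (p.2 - a.2) * (b.2 - a.2)) / ((b.1 - a.1) ^ 2 + (b.2 - a.2) ^ 2), ?_⟩
      unfold det2 at h0
      ext
      · simp
        field_simp
        linear_combination (-(b.2 - a.2)) * h0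
      · simp
        field_simp
        linear_combination ((b.1 - a.1)) * h0
  rcases hcol.wbtw_or_wbtw_or_wbtw with h1 | h1 | h1
  · exact hbet _ _ _ ha hb hc hab.symm hbc h1
  · exact hbet _ _ _ hb hc ha hbc.symm hac.symm h1
  · exact hbet _ _ _ hc ha hb hac hab h1

theorem det2_cyc (a b c : Pt) : det2 b c a = det2 a b c := by unfold det2; ring

theorem det2_swap (a b c : Pt) : det2 b a c = - det2 a b c := by unfold det2; ring

theorem det2_self (a b : Pt) : det2 a b b = 0 := by unfold det2; ring

theorem det2_tr {S : Set Pt} (h : ConvexPos S) {d a b c : Pt} (hd : d ∈ S) (ha : a ∈ S) (hb : b ∈ S)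
    (hc : c ∈ S) (h1 : 0 < det2 d a b) (h2 : 0 < det2 d b c) : 0 < det2 d a c := by
  by_contra hneg
  have hda : d ≠ a := by rintro rfl; unfold det2 at h1; simp at h1
  have hdb : d ≠ b := by rintro rfl; unfold det2 at h2; simp at h2
  have hdc : d ≠ c := by rintro rfl; unfold det2 at h2; simp at h2
  have hac : a ≠ c := by
    rintro rfl
    unfold det2 at h1 h2; linarith
  have h3 : 0 < - det2 d a c :=
    lt_of_le_of_ne (by linarith) (by intro hh; exact det2_ne h hd ha hc hda hdc hac (by linarith))
  refine h d hd ?_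
  set u := det2 d a b with hu
  set v := det2 d b c with hv
  set w := - det2 d a c with hw
  have hs : 0 < u + v + w := by linarith
  have hA : a ∈ convexHull ℝ (S \ {d}) := subset_convexHull ℝ _ ⟨ha, fun h => hda (Set.mem_singleton_iff.1 h).symm⟩
  have hB : b ∈ convexHull ℝ (S \ {d}) := subset_convexHull ℝ _ ⟨hb, fun h => hdb (Set.mem_singleton_iff.1 h).symm⟩
  have hC : c ∈ convexHull ℝ (S \ {d}) := subset_convexHull ℝ _ ⟨hc, fun h => hdc (Set.mem_singleton_iff.1 h).symm⟩
  have hcv := convex_convexHull ℝ (S \ {d})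
  have hAB := hcv hA hB (show 0 ≤ v / (v + w) by positivity) (show 0 ≤ w / (v + w) by positivity) (by field_simp)
  have hABC := hcv hAB hC (show 0 ≤ (v + w) / (u + v + w) by positivity) (show 0 ≤ u / (u + v + w) by positivity) (by field_simp; ring)
  convert hABC using 1
  have hvw : v + w ≠ 0 := by positivity
  have hs' : u + v + w ≠ 0 := hs.ne'
  ext
  · simp
    field_simp
    rw [hu, hv, hw]; unfold det2; ring
  · simp
    field_simp
    rw [hu, hv, hw]; unfold det2; ring

theorem det2_cross {S : Set Pt} (h : ConvexPos S) {a b c d : Pt} (ha : a ∈ S) (hb : b ∈ S) (hc : c ∈ S)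
    (hd : d ∈ S) (h1 : 0 < det2 a b c) (h2 : 0 < det2 b a d) :
    ∃ x, x ∈ openSegment ℝ a b ∧ x ∈ openSegment ℝ c d := by
  have hw : 0 < det2 a d c := det2_tr h ha hd hb hc (by unfold det2 at *; linarith) h1
  have hz : 0 < det2 b c d := det2_tr h hb hc ha hd (by unfold det2 at *; linarith) h2
  have hsum : det2 a b c + det2 b a d = det2 a d c + det2 b c d := by unfold det2; ring
  set u := det2 a b c with hu
  set v := det2 b a d with hv
  set w := det2 a d c with hw'
  set z := det2 b c d with hz'
  refine ⟨(z / (w + z)) • a + (w / (w + z)) • b, ⟨_, _, by positivity, by positivity, by field_simp; ring, rfl⟩,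
    ⟨v / (u + v), u / (u + v), by positivity, by positivity, by field_simp; ring, ?_⟩⟩
  rw [← hsum]
  have : u + v ≠ 0 := by positivity
  ext
  · simp
    field_simp
    rw [hu, hv, hw', hz']; unfold det2; ring
  · simp
    field_simp
    rw [hu, hv, hw', hz']; unfold det2; ring

/-- Let `S` be a set of `2n` points in convex position, `n ≥ 4`. If
`F 1, …, F m` are pairwise edge-disjoint non-crossing perfect matchings on `S` whose union
is a triangle-free plane geometric graph (the union itself is non-crossing and
triangle-free), then `m ≤ 2`. -/
theorem stmt15 (n : ℕ) (hn : 4 ≤ n) (S : Finset Pt) (hcard : S.card = 2 * n)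
    (hcp : ConvexPos (S : Set Pt)) (m : ℕ) (F : Fin m → Set (Set Pt))
    (hpm : ∀ i, IsPerfectMatching (S : Set Pt) (F i))
    (hnc : ∀ i, NonCrossing (F i))
    (hdisj : ∀ i j, i ≠ j → Disjoint (F i) (F j))
    (hplane : NonCrossing (⋃ i, F i))
    (htf : TriangleFree (⋃ i, F i)) :
    m ≤ 2 := by
  by_contra hm
  push Not at hm
  have hne : Nonempty (S : Set Pt) := by
    have : 0 < S.card := by omega
    obtain ⟨p, hp⟩ := Finset.card_pos.1 this
    exact ⟨⟨p, hp⟩⟩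
  have hpart : ∀ i, ∀ p ∈ (S : Set Pt), ∃ q ∈ (S : Set Pt), p ≠ q ∧ ({p, q} : Set Pt) ∈ F i := by
    intro i p hp
    obtain ⟨e, ⟨he, hpe⟩, -⟩ := (hpm i).2 p hp
    obtain ⟨a, b, hab, ha, hb, rfl⟩ := (hpm i).1 e he
    rcases hpe with rfl | hpe
    · exact ⟨b, hb, hab, he⟩
    · rw [Set.mem_singleton_iff] at hpe
      subst hpe
      exact ⟨a, ha, hab.symm, by rwa [Set.pair_comm]⟩
  refine comb_aux (V := (S : Set Pt)) (fun a b c => 0 < det2 a.1 b.1 c.1)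
    (fun a b => a ≠ b ∧ ({a.1, b.1} : Set Pt) ∈ ⋃ i, F i) ?_ ?_ ?_ ?_ ?_ ?_ ?_ ?_
  · intro a b c h
    rwa [det2_cyc]
  · intro a b c h
    rw [det2_swap]; linarith
  · intro a b c hab hac hbc
    have := det2_ne hcp a.2 b.2 c.2 (fun h => hab (Subtype.ext h)) (fun h => hac (Subtype.ext h))
      (fun h => hbc (Subtype.ext h))
    rw [det2_swap a.1 b.1]
    rcases lt_or_gt_of_ne this with h | h
    · right; linarith
    · left; exact h
  · intro d a b c h1 h2
    exact det2_tr hcp d.2 a.2 b.2 c.2 h1 h2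
  · rintro a b ⟨h1, h2⟩
    exact ⟨h1.symm, by rwa [Set.pair_comm]⟩
  · exact fun a b h => h.1
  · rintro a b c d ⟨hab, h1⟩ ⟨hcd, h2⟩ h3 h4
    obtain ⟨x, hx1, hx2⟩ := det2_cross hcp a.2 b.2 c.2 d.2 h3 h4
    have hne' : ({a.1, b.1} : Set Pt) ≠ {c.1, d.1} := by
      intro hh
      have : c.1 ∈ ({a.1, b.1} : Set Pt) := by rw [hh]; simp
      rcases this with h | h
      · rw [h] at h3; unfold det2 at h3; simp at h3
      · rw [Set.mem_singleton_iff] at h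
        rw [h] at h3; rw [det2_self] at h3; exact lt_irrefl _ h3
    have := hplane _ h1 _ h2 hne'
    have hmem : x ∈ openSeg ({a.1, b.1} : Set Pt) ∩ openSeg ({c.1, d.1} : Set Pt) :=
      ⟨⟨a.1, by simp, b.1, by simp, fun h => hab (Subtype.ext h), hx1⟩,
        ⟨c.1, by simp, d.1, by simp, fun h => hcd (Subtype.ext h), hx2⟩⟩
    rw [this] at hmem
    exact hmem
  · intro p
    choose q hqS hpq hqF using fun i => hpart i p.1 p.2
    have hinj : ∀ i j, i ≠ j → (⟨q i, hqS i⟩ : (S : Set Pt)) ≠ ⟨q j, hqS j⟩ := by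
      intro i j hij h
      have h' : q i = q j := congrArg Subtype.val h
      have h1 := hqF i
      rw [h'] at h1
      exact Set.disjoint_left.1 (hdisj i j hij) h1 (hqF j)
    have hadj : ∀ i, p ≠ (⟨q i, hqS i⟩ : (S : Set Pt)) ∧ ({p.1, q i} : Set Pt) ∈ ⋃ i, F i := by
      intro i
      exact ⟨fun h => hpq i (congrArg Subtype.val h), Set.mem_iUnion.2 ⟨i, hqF i⟩⟩
    refine ⟨_, _, _, hinj ⟨0, by omega⟩ ⟨1, by omega⟩ (by simp), hinj ⟨0, by omega⟩ ⟨2, by omega⟩ (by simp),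
      hinj ⟨1, by omega⟩ ⟨2, by omega⟩ (by simp), hadj _, hadj _, hadj _⟩
end
end
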